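/- arXiv:1501.03122 — 4 statements merged into one kernel-verified Lean document; each statement's English description precedes it below -/
import Mathlib

section
/- Let (f^{i,j}, g^j) (1 ≤ i,j ≤ m) satisfy hypotheses (H), and suppose additionally that f^{i,j} is piecewise constant for every i ≠ j and g^j is piecewise constant for every j; that is, f^{i,j} = Σ_{k≥1} x^{i,j}_k 1_{[t^{i,j}_{k−1}, t^{i,j}_k)} and g^j = Σ_{k≥1} y^j_k 1_{[t^j_{k−1}, t^j_k)}, where the sequences of change points 0 = t^{i,j}_0 ≤ t^{i,j}_1 ≤ … and 0 = t^j_0 ≤ t^j_1 ≤ … have no accumulation points. Then there exist τ ∈ (0,∞] and a non-negative solution h of the time-change system on [0,τ) such that, if τ < ∞, then c^j(τ−) = ∞ for some j (where c^j(t) = ∫_0^t h^j(s) ds). -/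
open MeasureTheory Filter Function Set
open scoped ENNReal Topology

noncomputable section

/-- A function is càdlàg on `[0, τ)`: right-continuous at every `t ∈ [0, τ)` and with
left limits at every `t ∈ (0, τ)` (times are compared with `τ : ℝ≥0∞` via `ENNReal.ofReal`). -/
def CadlagOn (f : ℝ → ℝ) (τ : ℝ≥0∞) : Prop :=
  (∀ t : ℝ, 0 ≤ t → ENNReal.ofReal t < τ →
    Tendsto f (nhdsWithin t (Set.Ioi t)) (nhds (f t))) ∧
  (∀ t : ℝ, 0 < t → ENNReal.ofReal t < τ →
    ∃ l : ℝ, Tendsto f (nhdsWithin t (Set.Iio t)) (nhds l))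

/-- Càdlàg on all of `[0, ∞)`. -/
def Cadlag (f : ℝ → ℝ) : Prop := CadlagOn f ⊤

/-- Hypotheses (H) on the driving functions of the time-change system. -/
structure HypH (m : ℕ) (f : Fin m → Fin m → ℝ → ℝ) (g : Fin m → ℝ → ℝ) : Prop where
  cadlag_f : ∀ i j, Cadlag (f i j)
  cadlag_g : ∀ j, Cadlag (g j)
  /-- H1: the diagonal entries have no negative jumps -/
  no_neg_jumps : ∀ i, ∀ t : ℝ, 0 < t → Function.leftLim (f i i) t ≤ f i i t
  /-- H1: the off-diagonal entries are non-decreasing -/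
  mono_f : ∀ i j, i ≠ j → MonotoneOn (f i j) (Set.Ici 0)
  /-- H2 -/
  mono_g : ∀ j, MonotoneOn (g j) (Set.Ici 0)
  /-- H3 -/
  init_nonneg : ∀ j, 0 ≤ g j 0 + ∑ i, f i j 0

/-- The primitive `c(t) = ∫_0^t h(s) ds`. -/
def prim (h : ℝ → ℝ) (t : ℝ) : ℝ := ∫ s in (0:ℝ)..t, h s

/-- `h` solves the time-change system `h^j = Σ_i f^{i,j}∘c^i + g^j` on `[0, τ)`,
where `c^i` is the primitive of `h^i`. -/
def IsSolutionOn (m : ℕ) (f : Fin m → Fin m → ℝ → ℝ) (g : Fin m → ℝ → ℝ)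
    (τ : ℝ≥0∞) (h : Fin m → ℝ → ℝ) : Prop :=
  (∀ j, CadlagOn (h j) τ) ∧
  ∀ j, ∀ t : ℝ, 0 ≤ t → ENNReal.ofReal t < τ →
    h j t = (∑ i, f i j (prim (h i) t)) + g j t

/-- Non-negativity of a solution on `[0, τ)`. -/
def NonnegOn (m : ℕ) (τ : ℝ≥0∞) (h : Fin m → ℝ → ℝ) : Prop :=
  ∀ j, ∀ t : ℝ, 0 ≤ t → ENNReal.ofReal t < τ → 0 ≤ h j t

/-- The primitive of some coordinate of `h` tends to `∞` at `τ`. -/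
def ExplodesAt (m : ℕ) (τ : ℝ≥0∞) (h : Fin m → ℝ → ℝ) : Prop :=
  ∃ j : Fin m, ∀ M : ℝ, ∃ t : ℝ, 0 ≤ t ∧ ENNReal.ofReal t < τ ∧ M ≤ prim (h j) t

/-- A non-negative solution `h` of the time-change system on `[0, τ)` has no spontaneous
generation: whenever `h^j(s) = 0` for all `j ∈ J` and the primitive `c^j` increases strictly
at `s` for some `j ∈ J`, either `g^j` increases strictly to the right of `s`, or
`f^{i,j} ∘ c^i` increases strictly to the right of `s` for some `i ∉ J`. -/
def NoSpontGenOn (m : ℕ) (f : Fin m → Fin m → ℝ → ℝ) (g : Fin m → ℝ → ℝ)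
    (τ : ℝ≥0∞) (h : Fin m → ℝ → ℝ) : Prop :=
  ∀ s : ℝ, 0 ≤ s → ENNReal.ofReal s < τ →
    ∀ J : Finset (Fin m), (∀ j ∈ J, h j s = 0) →
      ∀ j ∈ J, (∀ t : ℝ, s < t → ENNReal.ofReal t < τ → prim (h j) s < prim (h j) t) →
        (∀ t : ℝ, s < t → ENNReal.ofReal t < τ → g j s < g j t) ∨
        ∃ i : Fin m, i ∉ J ∧
          ∀ t : ℝ, s < t → ENNReal.ofReal t < τ → f i j (prim (h i) s) < f i j (prim (h i) t)

/-- `φ` is piecewise constant with change points given by a non-decreasing sequence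
`t_0 = 0 ≤ t_1 ≤ …` without accumulation points. -/
def PiecewiseConst (φ : ℝ → ℝ) : Prop :=
  ∃ t : ℕ → ℝ, t 0 = 0 ∧ Monotone t ∧ Tendsto t atTop atTop ∧
    ∀ k : ℕ, ∀ s : ℝ, t k ≤ s → s < t (k + 1) → φ s = φ (t k)

/-- Right-continuous functions are measurable. -/
lemma aux_meas (F : ℝ → ℝ) (h : ∀ x, ContinuousWithinAt F (Ioi x) x) : Measurable F := by
  refine measurable_of_tendsto_metrizable
    (f := fun (n : ℕ) x => F ((⌊((n:ℝ)+1) * x⌋ + 1 : ℝ) / ((n:ℝ)+1))) ?_ ?_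
  · intro n
    have h1 : Measurable (fun k : ℤ => F (((k:ℝ) + 1) / ((n:ℝ)+1))) := measurable_from_top
    have h2 : Measurable (fun x : ℝ => ⌊((n:ℝ)+1) * x⌋) :=
      Int.measurable_floor.comp (measurable_const.mul measurable_id)
    exact h1.comp h2
  · rw [tendsto_pi_nhds]
    intro x
    refine (h x).tendsto.comp ?_
    refine tendsto_nhdsWithin_iff.2 ⟨?_, Eventually.of_forall fun n => ?_⟩
    · have hlim : Tendsto (fun n : ℕ => x + 1 / ((n:ℝ)+1)) atTop (𝓝 (x + 0)) :=
        tendsto_const_nhds.add tendsto_one_div_add_atTop_nhds_zero_nat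
      rw [add_zero] at hlim
      refine tendsto_of_tendsto_of_tendsto_of_le_of_le tendsto_const_nhds hlim ?_ ?_
      · intro n
        have hn : (0:ℝ) < (n:ℝ)+1 := by positivity
        simp only
        rw [le_div_iff₀ hn]
        have := Int.lt_floor_add_one (((n:ℝ)+1) * x)
        linarith
      · intro n
        have hn : (0:ℝ) < (n:ℝ)+1 := by positivity
        simp only
        rw [div_le_iff₀ hn, add_mul x, one_div, inv_mul_cancel₀ hn.ne']
        have := Int.floor_le (((n:ℝ)+1) * x)
        linarith
    · have hn : (0:ℝ) < (n:ℝ)+1 := by positivity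
      rw [mem_Ioi, lt_div_iff₀ hn]
      have := Int.lt_floor_add_one (((n:ℝ)+1) * x)
      linarith

/-- Inverse of the primitive of a positive, bounded right-continuous function. -/
lemma aux_inv (φ : ℝ → ℝ) (a b x0 : ℝ) (ha : 0 < a) (h : ∀ x, ContinuousWithinAt φ (Ioi x) x)
    (hlo : ∀ x, a ≤ φ x) (hhi : ∀ x, φ x ≤ b) :
    ∃ c : ℝ → ℝ, Continuous c ∧ Monotone c ∧ c 0 = x0 ∧
      ∀ t, HasDerivWithinAt c (φ (c t))⁻¹ (Ici t) t := by
  have hm : Measurable φ := aux_meas φ h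
  have hint : ∀ x y, IntervalIntegrable φ volume x y := by
    intro x y
    refine (intervalIntegrable_const (c := b)).mono_fun hm.aestronglyMeasurable ?_
    refine Eventually.of_forall fun s => ?_
    simp only [Real.norm_eq_abs]
    rw [abs_of_nonneg (ha.le.trans (hlo s))]
    exact (hhi s).trans (le_abs_self _)
  set I : ℝ → ℝ := fun x => ∫ s in x0..x, φ s with hI
  have hIcont : Continuous I := intervalIntegral.continuous_primitive hint x0
  have hinc : ∀ x y, x ≤ y → a * (y - x) ≤ I y - I x := by
    intro x y hxy
    have h1 : I y - I x = ∫ s in x..y, φ s :=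
      intervalIntegral.integral_interval_sub_left (hint _ _) (hint _ _)
    rw [h1]
    have h2 : ∫ s in x..y, a ≤ ∫ s in x..y, φ s :=
      intervalIntegral.integral_mono_on hxy intervalIntegrable_const (hint _ _) fun s _ => hlo s
    rw [intervalIntegral.integral_const, smul_eq_mul] at h2
    linarith
  have hmono : StrictMono I := by
    intro x y hxy
    have := hinc x y hxy.le
    have := mul_pos ha (sub_pos.2 hxy)
    linarith
  have hI0 : I x0 = 0 := by simp [hI]
  have htop : Tendsto I atTop atTop := by
    have h1 : Tendsto (fun x : ℝ => a * (x - x0)) atTop atTop :=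
      (tendsto_atTop_add_const_right _ (-x0) tendsto_id).const_mul_atTop ha
    refine tendsto_atTop_mono' _ ?_ h1
    filter_upwards [eventually_ge_atTop x0] with x hx
    have := hinc x0 x hx
    linarith
  have hbot : Tendsto I atBot atBot := by
    have h1 : Tendsto (fun x : ℝ => a * (x - x0)) atBot atBot :=
      (tendsto_atBot_add_const_right _ (-x0) tendsto_id).const_mul_atBot ha
    refine tendsto_atBot_mono' _ ?_ h1
    filter_upwards [eventually_le_atBot x0] with x hx
    have := hinc x x0 hx
    linarith
  have hsurj : Surjective I := hIcont.surjective htop hbot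
  set e := hmono.orderIsoOfSurjective I hsurj with he
  have hIe : ∀ t, I (e.symm t) = t := fun t => e.apply_symm_apply t
  refine ⟨e.symm, e.symm.continuous, e.symm.monotone, ?_, ?_⟩
  · apply hmono.injective
    rw [hIe, hI0]
  · intro t
    have hd : HasDerivWithinAt I (φ (e.symm t)) (Ici (e.symm t)) (e.symm t) := by
      refine intervalIntegral.integral_hasDerivWithinAt_right (hint _ _) (t := Ioi (e.symm t)) ?_
        (h _)
      exact hm.stronglyMeasurable.stronglyMeasurableAtFilter
    have hne : φ (e.symm t) ≠ 0 := (ha.trans_le (hlo _)).ne'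
    have hg : Tendsto e.symm (𝓝[>] t) (𝓝[>] (e.symm t)) := by
      refine tendsto_nhdsWithin_of_tendsto_nhds_of_eventually_within _
        (e.symm.continuous.continuousAt.tendsto.mono_left nhdsWithin_le_nhds) ?_
      filter_upwards [self_mem_nhdsWithin] with s hs
      exact e.symm.strictMono hs
    rw [← hasDerivWithinAt_Ioi_iff_Ici, hasDerivWithinAt_iff_tendsto_slope' (by simp)] at hd ⊢
    have := (hd.comp hg).inv₀ hne
    refine this.congr fun s => ?_
    simp only [Function.comp_apply, slope_def_field, hIe, inv_div]

/-- Local existence in dimension one. -/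
lemma aux_local1 (F : ℝ → ℝ) (x0 : ℝ) (hF : ∀ x, x0 ≤ x → ContinuousWithinAt F (Ioi x) x)
    (h0 : 0 ≤ F x0) :
    ∃ c : ℝ → ℝ, Continuous c ∧ Monotone c ∧ c 0 = x0 ∧
      ∀ᶠ t in 𝓝[≥] (0:ℝ), 0 ≤ F (c t) ∧ HasDerivWithinAt c (F (c t)) (Ici t) t := by
  rcases h0.eq_or_lt with h0 | h0
  · refine ⟨fun _ => x0, continuous_const, monotone_const, rfl, Eventually.of_forall fun t => ?_⟩
    simp only [← h0]
    exact ⟨le_rfl, hasDerivWithinAt_const _ _ _⟩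
  · set y := F x0 with hy
    set ψ : ℝ → ℝ := fun x => max (y/2) (min (2*y) (F (max x x0))) with hψ
    have hψpos : ∀ x, 0 < ψ x := fun x => lt_of_lt_of_le (half_pos h0) (le_max_left _ _)
    have hψle : ∀ x, ψ x ≤ 2 * y := fun x => max_le (by linarith) (min_le_left _ _)
    have hψc : ∀ x, ContinuousWithinAt ψ (Ioi x) x := by
      intro x
      have h1 : ContinuousWithinAt (fun x => F (max x x0)) (Ioi x) x := by
        rcases lt_or_ge x x0 with hx | hx
        · have : ContinuousAt (fun x => F (max x x0)) x := by
            refine (continuousAt_const (y := F x0)).congr ?_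
            filter_upwards [Iio_mem_nhds hx] with z hz
            rw [max_eq_right (le_of_lt hz)]
          exact this.continuousWithinAt
        · refine ((hF x hx).congr_of_eventuallyEq ?_ ?_)
          · filter_upwards [self_mem_nhdsWithin] with z hz
            rw [max_eq_left (hx.trans (le_of_lt hz))]
          · rw [max_eq_left hx]
      exact continuousWithinAt_const.max (continuousWithinAt_const.min h1)
    obtain ⟨c, hc, hcm, hc0, hcd⟩ := aux_inv (fun x => (ψ x)⁻¹) (2*y)⁻¹ (y/2)⁻¹ x0
      (by positivity) (fun x => (hψc x).inv₀ (hψpos x).ne')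
      (fun x => inv_anti₀ (hψpos x) (hψle x))
      (fun x => inv_anti₀ (half_pos h0) (le_max_left _ _))
    refine ⟨c, hc, hcm, hc0, ?_⟩
    have hlim : Tendsto c (𝓝[≥] (0:ℝ)) (𝓝[≥] x0) := by
      refine tendsto_nhdsWithin_of_tendsto_nhds_of_eventually_within _ ?_ ?_
      · have := hc.continuousAt (x := (0:ℝ)) |>.tendsto
        rw [hc0] at this
        exact this.mono_left nhdsWithin_le_nhds
      · filter_upwards [self_mem_nhdsWithin] with s hs
        rw [← hc0]
        exact hcm hs
    have hev : ∀ᶠ x in 𝓝[≥] x0, ψ x = F x := by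
      have hci : ContinuousWithinAt F (Ici x0) x0 := continuousWithinAt_Ioi_iff_Ici.1 (hF x0 le_rfl)
      have h1 : ∀ᶠ x in 𝓝[≥] x0, y/2 < F x :=
        hci.tendsto.eventually (lt_mem_nhds (half_lt_self h0))
      have h2 : ∀ᶠ x in 𝓝[≥] x0, F x < 2 * y :=
        hci.tendsto.eventually (gt_mem_nhds (by linarith))
      filter_upwards [h1, h2, self_mem_nhdsWithin] with x h1 h2 h3
      simp only [hψ]
      have h4 : max x x0 = x := max_eq_left h3
      rw [h4, min_eq_right h2.le, max_eq_right h1.le]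
    filter_upwards [hlim.eventually hev] with t ht
    have := hcd t
    simp only [inv_inv] at this
    rw [← ht]
    exact ⟨(hψpos _).le, this⟩

/-- Piecewise constant functions are locally constant to the right. -/
lemma aux_pc (φ : ℝ → ℝ) (h : PiecewiseConst φ) (x : ℝ) (hx : 0 ≤ x) :
    ∀ᶠ s in 𝓝[≥] x, φ s = φ x := by
  obtain ⟨t, ht0, -, htt, hφ⟩ := h
  have hex : ∃ n, x < t n := (htt.eventually_gt_atTop x).exists
  classical
  have hs := Nat.find_spec hex
  have hmin := fun k => Nat.find_min hex (m := k)
  rcases hn : Nat.find hex with _ | k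
  · rw [hn, ht0] at hs
    linarith
  · rw [hn] at hs
    have hk : t k ≤ x := not_lt.1 (hmin k (by omega))
    filter_upwards [self_mem_nhdsWithin, mem_nhdsWithin_of_mem_nhds (Iio_mem_nhds hs)] with s h1 h2
    rw [hφ k s (hk.trans h1) h2, hφ k x hk hs]

/-- The right-hand side of the system. -/
def auxH (m : ℕ) (f : Fin m → Fin m → ℝ → ℝ) (g : Fin m → ℝ → ℝ) (c : Fin m → ℝ → ℝ)
    (j : Fin m) (t : ℝ) : ℝ := (∑ i, f i j (c i t)) + g j t

/-- Local existence for the system. -/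
lemma aux_local (m : ℕ) (f : Fin m → Fin m → ℝ → ℝ) (g : Fin m → ℝ → ℝ)
    (hH : HypH m f g) (hpc_f : ∀ i j, i ≠ j → PiecewiseConst (f i j))
    (hpc_g : ∀ j, PiecewiseConst (g j)) (t0 : ℝ) (ht0 : 0 ≤ t0) (v : Fin m → ℝ)
    (hv : ∀ j, 0 ≤ v j) (h0 : ∀ j, 0 ≤ (∑ i, f i j (v i)) + g j t0) :
    ∃ d : Fin m → ℝ → ℝ, (∀ j, Continuous (d j)) ∧ (∀ j, d j t0 = v j) ∧
      ∀ᶠ t in 𝓝[≥] t0, ∀ j, 0 ≤ auxH m f g d j t ∧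
        HasDerivWithinAt (d j) (auxH m f g d j t) (Ici t) t := by
  have key : ∀ j, ∃ c : ℝ → ℝ, Continuous c ∧ Monotone c ∧ c 0 = v j ∧
      ∀ᶠ t in 𝓝[≥] (0:ℝ), 0 ≤ f j j (c t) + (∑ i ∈ Finset.univ.erase j, f i j (v i) + g j t0) ∧
        HasDerivWithinAt c (f j j (c t) + (∑ i ∈ Finset.univ.erase j, f i j (v i) + g j t0))
          (Ici t) t := by
    intro j
    refine aux_local1 (fun x => f j j x + (∑ i ∈ Finset.univ.erase j, f i j (v i) + g j t0)) (v j)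
      ?_ ?_
    · intro x hx
      exact ContinuousWithinAt.add ((hH.cadlag_f j j).1 x ((hv j).trans hx) (by simp))
        continuousWithinAt_const
    · have := h0 j
      rw [← Finset.add_sum_erase _ _ (Finset.mem_univ j)] at this
      linarith
  choose c hc hcm hc0 hcd using key
  have hshift : Tendsto (fun t : ℝ => t - t0) (𝓝[≥] t0) (𝓝[≥] (0:ℝ)) := by
    refine tendsto_nhdsWithin_of_tendsto_nhds_of_eventually_within _ ?_ ?_
    · have : Tendsto (fun t : ℝ => t - t0) (𝓝 t0) (𝓝 (t0 - t0)) :=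
        (continuous_id.sub continuous_const).tendsto t0
      rw [sub_self] at this
      exact this.mono_left nhdsWithin_le_nhds
    · filter_upwards [self_mem_nhdsWithin] with s hs
      have hs' : t0 ≤ s := hs
      exact sub_nonneg.2 hs'
  have hlim : ∀ j, Tendsto (fun t => c j (t - t0)) (𝓝[≥] t0) (𝓝[≥] (v j)) := by
    intro j
    refine Tendsto.comp ?_ hshift
    refine tendsto_nhdsWithin_of_tendsto_nhds_of_eventually_within _ ?_ ?_
    · have := (hc j).continuousAt (x := (0:ℝ)) |>.tendsto
      rw [hc0] at this
      exact this.mono_left nhdsWithin_le_nhds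
    · filter_upwards [self_mem_nhdsWithin] with s hs
      rw [← hc0]
      exact hcm j hs
  refine ⟨fun j t => c j (t - t0), fun j => (hc j).comp (continuous_id.sub continuous_const),
    fun j => by simp [hc0], ?_⟩
  rw [eventually_all]
  intro j
  have hoff : ∀ᶠ t in 𝓝[≥] t0, ∀ i, i ≠ j → f i j (c i (t - t0)) = f i j (v i) := by
    rw [eventually_all]
    intro i
    by_cases hij : i = j
    · exact Eventually.of_forall fun _ h => absurd hij h
    · filter_upwards [(hlim i).eventually (aux_pc _ (hpc_f i j hij) (v i) (hv i))] with t ht _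
      exact ht
  filter_upwards [hoff, aux_pc _ (hpc_g j) t0 ht0, hshift.eventually (hcd j)] with t h1 h2 h3
  have hEq : auxH m f g (fun j t => c j (t - t0)) j t =
      f j j (c j (t - t0)) + (∑ i ∈ Finset.univ.erase j, f i j (v i) + g j t0) := by
    unfold auxH
    rw [← Finset.add_sum_erase _ _ (Finset.mem_univ j), h2, add_assoc]
    congr 2
    exact Finset.sum_congr rfl fun i hi => h1 i (Finset.ne_of_mem_erase hi)
  rw [hEq]
  refine ⟨h3.1, ?_⟩
  have hs : HasDerivWithinAt (fun t : ℝ => t - t0) 1 (Ici t) t :=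
    ((hasDerivAt_id t).sub_const t0).hasDerivWithinAt
  have := h3.2.comp t hs (fun s (hs : t ≤ s) => by
    show t - t0 ≤ s - t0
    linarith)
  simpa [Function.comp_def] using this

/-- Partial solutions, in terms of the primitives. -/
structure AuxGood (m : ℕ) (f : Fin m → Fin m → ℝ → ℝ) (g : Fin m → ℝ → ℝ) (τ : ℝ≥0∞)
    (c : Fin m → ℝ → ℝ) : Prop where
  zero : ∀ j, c j 0 = 0
  nonneg : ∀ j t, 0 ≤ t → ENNReal.ofReal t < τ → 0 ≤ auxH m f g c j t
  deriv : ∀ j t, 0 ≤ t → ENNReal.ofReal t < τ →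
    HasDerivWithinAt (c j) (auxH m f g c j t) (Ici t) t
  cont : ∀ j t, 0 ≤ t → ENNReal.ofReal t < τ → ContinuousWithinAt (c j) (Icc 0 t) t

section good

variable {m : ℕ} {f : Fin m → Fin m → ℝ → ℝ} {g : Fin m → ℝ → ℝ} {τ : ℝ≥0∞} {c : Fin m → ℝ → ℝ}

lemma AuxGood.contOn (h : AuxGood m f g τ c) (j : Fin m) (t : ℝ) (ht : ENNReal.ofReal t < τ) :
    ContinuousOn (c j) (Icc 0 t) := by
  intro s hs
  have hsτ := (ENNReal.ofReal_le_ofReal hs.2).trans_lt ht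
  have h1 := (h.cont j s hs.1 hsτ).union (h.deriv j s hs.1 hsτ).continuousWithinAt
  refine h1.mono fun u hu => ?_
  rcases le_total u s with hus | hus
  · exact Or.inl ⟨hu.1, hus⟩
  · exact Or.inr hus

lemma AuxGood.mono (h : AuxGood m f g τ c) (j : Fin m) (s t : ℝ) (hs : 0 ≤ s) (hst : s ≤ t)
    (ht : ENNReal.ofReal t < τ) : c j s ≤ c j t := by
  have hlt : ∀ x ∈ Ico s t, ENNReal.ofReal x < τ := fun x hx =>
    (ENNReal.ofReal_le_ofReal hx.2.le).trans_lt ht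
  exact image_le_of_deriv_right_le_deriv_boundary (f := fun _ => c j s) (f' := fun _ => 0)
    continuousOn_const (fun x _ => hasDerivWithinAt_const _ _ _) (B := c j)
    (B' := auxH m f g c j) le_rfl ((h.contOn j t ht).mono (Icc_subset_Icc_left hs))
    (fun x hx => h.deriv j x (hs.trans hx.1) (hlt x hx))
    (fun x hx => h.nonneg j x (hs.trans hx.1) (hlt x hx)) (right_mem_Icc.2 hst)

lemma AuxGood.prim_eq (h : AuxGood m f g τ c) (j : Fin m) (t : ℝ) (h0 : 0 ≤ t)
    (ht : ENNReal.ofReal t < τ) : prim (auxH m f g c j) t = c j t := by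
  have hlt : ∀ x ∈ Ioo 0 t, ENNReal.ofReal x < τ := fun x hx =>
    (ENNReal.ofReal_le_ofReal hx.2.le).trans_lt ht
  have hd : ∀ x ∈ Ioo 0 t, HasDerivWithinAt (c j) (auxH m f g c j x) (Ioi x) x :=
    fun x hx => (h.deriv j x hx.1.le (hlt x hx)).mono Ioi_subset_Ici_self
  have hI := intervalIntegral.integrableOn_deriv_right_of_nonneg (h.contOn j t ht) hd
    (fun x hx => h.nonneg j x hx.1.le (hlt x hx))
  have := intervalIntegral.integral_eq_sub_of_hasDeriv_right_of_le h0 (h.contOn j t ht) hd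
    ((intervalIntegrable_iff_integrableOn_Ioc_of_le h0).2 hI)
  rw [prim, this, h.zero, sub_zero]

lemma aux_nnj_of_mono (F : ℝ → ℝ) (hF : Cadlag F) (hm : MonotoneOn F (Ici 0)) (t : ℝ)
    (ht : 0 < t) : Function.leftLim F t ≤ F t := by
  obtain ⟨l, hl⟩ := hF.2 t ht (by simp)
  rw [leftLim_eq_of_tendsto hl]
  refine le_of_tendsto hl ?_
  filter_upwards [Ioo_mem_nhdsLT ht] with s hs
  exact hm hs.1.le ht.le hs.2.le

lemma aux_leftlim (F : ℝ → ℝ) (hF : Cadlag F) (hj : ∀ t, 0 < t → Function.leftLim F t ≤ F t)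
    (c : ℝ → ℝ) (T v : ℝ) (hT : 0 < T) (hc : MonotoneOn c (Ico 0 T)) (hc0 : c 0 = 0)
    (hv : Tendsto c (𝓝[<] T) (𝓝 v)) :
    ∃ l, l ≤ F v ∧ Tendsto (fun t => F (c t)) (𝓝[<] T) (𝓝 l) := by
  have hle : ∀ s ∈ Ico 0 T, c s ≤ v := by
    intro s hs
    refine ge_of_tendsto hv ?_
    filter_upwards [Ioo_mem_nhdsLT hs.2] with u hu
    exact hc hs ⟨hs.1.trans hu.1.le, hu.2⟩ hu.1.le
  by_cases hlt : ∀ s ∈ Ico 0 T, c s < v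
  · have hv0 : 0 < v := by
      rw [← hc0]
      exact hlt 0 ⟨le_rfl, hT⟩
    obtain ⟨l, hl⟩ := hF.2 v hv0 (by simp)
    refine ⟨l, ?_, hl.comp ?_⟩
    · rw [← leftLim_eq_of_tendsto hl]
      exact hj v hv0
    · refine tendsto_nhdsWithin_of_tendsto_nhds_of_eventually_within _ hv ?_
      filter_upwards [Ioo_mem_nhdsLT hT] with s hs
      exact hlt s ⟨hs.1.le, hs.2⟩
  · push Not at hlt
    obtain ⟨s, hs, hsv⟩ := hlt
    refine ⟨F v, le_rfl, tendsto_const_nhds.congr' ?_⟩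
    filter_upwards [Ioo_mem_nhdsLT hs.2] with u hu
    have hu' : u ∈ Ico 0 T := ⟨hs.1.trans hu.1.le, hu.2⟩
    have : c u = v := le_antisymm (hle u hu') (hsv.trans (hc hs hu' hu.1.le))
    rw [this]

lemma AuxGood.monoOn (h : AuxGood m f g τ c) (T : ℝ) (hT : ENNReal.ofReal T ≤ τ) (j : Fin m) :
    MonotoneOn (c j) (Ico 0 T) := by
  intro s hs t ht hst
  exact h.mono j s t hs.1 hst
    (((ENNReal.ofReal_lt_ofReal_iff (ht.1.trans_lt ht.2)).2 ht.2).trans_le hT)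

lemma AuxGood.leftlim (h : AuxGood m f g τ c) (hH : HypH m f g) (T : ℝ) (hT0 : 0 < T)
    (hT : ENNReal.ofReal T ≤ τ) (v : Fin m → ℝ) (hv : ∀ j, Tendsto (c j) (𝓝[<] T) (𝓝 (v j)))
    (j : Fin m) : ∃ l, l ≤ (∑ i, f i j (v i)) + g j T ∧
      Tendsto (auxH m f g c j) (𝓝[<] T) (𝓝 l) := by
  have key : ∀ i, ∃ l, l ≤ f i j (v i) ∧ Tendsto (fun t => f i j (c i t)) (𝓝[<] T) (𝓝 l) := by
    intro i
    refine aux_leftlim _ (hH.cadlag_f i j) ?_ _ T _ hT0 (h.monoOn T hT i) (h.zero i) (hv i)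
    intro t ht
    by_cases hij : i = j
    · subst hij
      exact hH.no_neg_jumps i t ht
    · exact aux_nnj_of_mono _ (hH.cadlag_f i j) (hH.mono_f i j hij) t ht
  choose l hl hlt using key
  obtain ⟨l', hl'⟩ := (hH.cadlag_g j).2 T hT0 (by simp)
  have hg := aux_nnj_of_mono _ (hH.cadlag_g j) (hH.mono_g j) T hT0
  rw [leftLim_eq_of_tendsto hl'] at hg
  exact ⟨(∑ i, l i) + l', add_le_add (Finset.sum_le_sum fun i _ => hl i) hg,
    (tendsto_finsetSum _ fun i _ => hlt i).add hl'⟩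

/-- Boundary values at a finite, non-explosive end time. -/
lemma AuxGood.boundary (T : ℝ) (hT0 : 0 ≤ T) (h : AuxGood m f g (ENNReal.ofReal T) c)
    (hH : HypH m f g)
    (hb : ∀ j, ∃ M, ∀ t, 0 ≤ t → t < T → c j t ≤ M) :
    ∃ v : Fin m → ℝ, (∀ j, 0 ≤ v j) ∧ (∀ j, 0 ≤ (∑ i, f i j (v i)) + g j T) ∧
      (T = 0 → ∀ j, v j = 0) ∧ (0 < T → ∀ j, Tendsto (c j) (𝓝[<] T) (𝓝 (v j))) := by
  rcases hT0.eq_or_lt with rfl | hT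
  · refine ⟨fun _ => 0, fun _ => le_rfl, fun j => ?_, fun _ _ => rfl, fun h => absurd h (lt_irrefl _)⟩
    have := hH.init_nonneg j
    linarith
  · have key : ∀ j, ∃ v, Tendsto (c j) (𝓝[<] T) (𝓝 v) := by
      intro j
      obtain ⟨M, hM⟩ := hb j
      have hmono : MonotoneOn (fun u => c j (max u 0)) (Iio T) := by
        intro s hs t ht hst
        exact h.monoOn T le_rfl j ⟨le_max_right _ _, max_lt hs hT⟩ ⟨le_max_right _ _, max_lt ht hT⟩
          (max_le_max hst le_rfl)
      have hbd : BddAbove ((fun u => c j (max u 0)) '' Iio T) := by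
        refine ⟨M, ?_⟩
        rintro _ ⟨u, hu, rfl⟩
        exact hM _ (le_max_right _ _) (max_lt hu hT)
      refine ⟨_, (hmono.tendsto_nhdsLT hbd).congr' ?_⟩
      filter_upwards [Ioo_mem_nhdsLT hT] with u hu
      rw [max_eq_left hu.1.le]
    choose v hv using key
    refine ⟨v, fun j => ?_, fun j => ?_, fun h => absurd h hT.ne', fun _ => hv⟩
    · refine ge_of_tendsto (hv j) ?_
      filter_upwards [Ioo_mem_nhdsLT hT] with u hu
      rw [← h.zero j]
      exact h.monoOn T le_rfl j ⟨le_rfl, hT⟩ ⟨hu.1.le, hu.2⟩ hu.1.le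
    · obtain ⟨l, hl, hlt⟩ := h.leftlim hH T hT le_rfl v hv j
      refine le_trans ?_ hl
      refine ge_of_tendsto hlt ?_
      filter_upwards [Ioo_mem_nhdsLT hT] with u hu
      exact h.nonneg j u hu.1.le ((ENNReal.ofReal_lt_ofReal_iff hT).2 hu.2)

lemma AuxGood.extend (hH : HypH m f g) (hpc_f : ∀ i j, i ≠ j → PiecewiseConst (f i j))
    (hpc_g : ∀ j, PiecewiseConst (g j)) (T : ℝ) (hT0 : 0 ≤ T)
    (h : AuxGood m f g (ENNReal.ofReal T) c)
    (hb : ∀ j, ∃ M, ∀ t, 0 ≤ t → t < T → c j t ≤ M) :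
    ∃ τ' c', ENNReal.ofReal T < τ' ∧ AuxGood m f g τ' c' ∧
      ∀ j t, ENNReal.ofReal t < ENNReal.ofReal T → c' j t = c j t := by
  obtain ⟨v, hv0, hvH, hvz, hvl⟩ := h.boundary T hT0 hH hb
  obtain ⟨d, hdc, hd0, hd⟩ := aux_local m f g hH hpc_f hpc_g T hT0 v hv0 hvH
  obtain ⟨S, hTS, hS⟩ := mem_nhdsGE_iff_exists_Ico_subset.1 hd
  have hTS : T < S := hTS
  set c' : Fin m → ℝ → ℝ := fun j t => if t < T then c j t else d j t with hc'
  have hlo : ∀ j t, t < T → c' j t = c j t := fun j t ht => by simp only [hc', if_pos ht]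
  have hhi : ∀ j t, T ≤ t → c' j t = d j t := fun j t ht => by
    simp only [hc', if_neg (not_lt.2 ht)]
  have hHlo : ∀ j t, t < T → auxH m f g c' j t = auxH m f g c j t := fun j t ht => by
    simp only [auxH, hlo _ t ht]
  have hHhi : ∀ j t, T ≤ t → auxH m f g c' j t = auxH m f g d j t := fun j t ht => by
    simp only [auxH, hhi _ t ht]
  have hlt : ∀ t, 0 ≤ t → t < T → ENNReal.ofReal t < ENNReal.ofReal T := fun t h0 ht =>
    (ENNReal.ofReal_lt_ofReal_iff (h0.trans_lt ht)).2 ht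
  have hltS : ∀ t, ENNReal.ofReal t < ENNReal.ofReal S → t < S := fun t ht =>
    (ENNReal.ofReal_lt_ofReal_iff (hT0.trans_lt hTS)).1 ht
  refine ⟨ENNReal.ofReal S, c', (ENNReal.ofReal_lt_ofReal_iff (hT0.trans_lt hTS)).2 hTS,
    ⟨?_, ?_, ?_, ?_⟩, ?_⟩
  · intro j
    rcases hT0.eq_or_lt with h0 | h0
    · rw [hhi j 0 h0.ge]
      have := hd0 j
      rw [← h0] at this
      rw [this, hvz h0.symm]
    · rw [hlo j 0 h0, h.zero]
  · intro j t h0 ht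
    rcases lt_or_ge t T with htT | htT
    · rw [hHlo j t htT]
      exact h.nonneg j t h0 (hlt t h0 htT)
    · rw [hHhi j t htT]
      exact (hS ⟨htT, hltS t ht⟩ j).1
  · intro j t h0 ht
    rcases lt_or_ge t T with htT | htT
    · rw [hHlo j t htT]
      refine (h.deriv j t h0 (hlt t h0 htT)).congr_of_eventuallyEq ?_ (hlo j t htT)
      filter_upwards [mem_nhdsWithin_of_mem_nhds (Iio_mem_nhds htT)] with s hs
      exact hlo j s hs
    · rw [hHhi j t htT]
      exact (hS ⟨htT, hltS t ht⟩ j).2.congr (fun s hs => hhi j s (htT.trans hs)) (hhi j t htT)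
  · intro j t h0 ht
    rcases lt_trichotomy t T with htT | rfl | htT
    · exact (h.cont j t h0 (hlt t h0 htT)).congr (fun s hs => hlo j s (hs.2.trans_lt htT))
        (hlo j t htT)
    · rcases hT0.eq_or_lt with h1 | h1
      · rw [← h1]
        simp
      · have : ContinuousWithinAt (c' j) (Iio t) t := by
          unfold ContinuousWithinAt
          rw [hhi j t le_rfl, hd0]
          refine (hvl h1 j).congr' ?_
          filter_upwards [self_mem_nhdsWithin] with s hs
          exact (hlo j s hs).symm
        exact (continuousWithinAt_Iio_iff_Iic.1 this).mono Icc_subset_Iic_self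
    · refine ((hdc j).continuousAt.congr ?_).continuousWithinAt
      filter_upwards [Ioi_mem_nhds htT] with s hs
      exact (hhi j s (le_of_lt hs)).symm
  · intro j t ht
    rcases lt_or_ge t T with htT | htT
    · exact hlo j t htT
    · exact absurd ht (not_lt.2 (ENNReal.ofReal_le_ofReal htT))

/-- Existence of a maximal partial solution. -/
lemma aux_maximal (m : ℕ) (f : Fin m → Fin m → ℝ → ℝ) (g : Fin m → ℝ → ℝ) :
    ∃ τ c, AuxGood m f g τ c ∧ ∀ τ' c', AuxGood m f g τ' c' → τ ≤ τ' →
      (∀ j t, ENNReal.ofReal t < τ → c' j t = c j t) → τ' ≤ τ := by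
  classical
  let P := {p : ℝ≥0∞ × (Fin m → ℝ → ℝ) // AuxGood m f g p.1 p.2}
  let r : P → P → Prop := fun p q => p.1.1 ≤ q.1.1 ∧
    ∀ j t, ENNReal.ofReal t < p.1.1 → q.1.2 j t = p.1.2 j t
  have hz := exists_maximal_of_chains_bounded (r := r) ?_ ?_
  · obtain ⟨p, hp⟩ := hz
    exact ⟨p.1.1, p.1.2, p.2, fun τ' c' hg hle heq => (hp ⟨(τ', c'), hg⟩ ⟨hle, heq⟩).1⟩
  · intro C hC
    let σ : ℝ≥0∞ := ⨆ p ∈ C, p.1.1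
    let d : Fin m → ℝ → ℝ := fun j t =>
      if hx : ∃ p ∈ C, ENNReal.ofReal t < p.1.1 then hx.choose.1.2 j t else 0
    have hagree : ∀ p ∈ C, ∀ j t, ENNReal.ofReal t < p.1.1 → d j t = p.1.2 j t := by
      intro p hp j t ht
      have hx : ∃ p ∈ C, ENNReal.ofReal t < p.1.1 := ⟨p, hp, ht⟩
      have hd : d j t = hx.choose.1.2 j t := dif_pos hx
      rw [hd]
      rcases eq_or_ne p hx.choose with h1 | hne
      · rw [← h1]
      rcases hC hp hx.choose_spec.1 hne with h1 | h1
      · exact h1.2 j t ht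
      · exact (h1.2 j t hx.choose_spec.2).symm
    have hHag : ∀ p ∈ C, ∀ j t, ENNReal.ofReal t < p.1.1 →
        auxH m f g d j t = auxH m f g p.1.2 j t := by
      intro p hp j t ht
      simp only [auxH, hagree p hp _ t ht]
    have hσ : ∀ t, ENNReal.ofReal t < σ → ∃ p ∈ C, ENNReal.ofReal t < p.1.1 := by
      intro t ht
      simpa [σ, lt_iSup_iff] using ht
    have hgood : AuxGood m f g σ d := by
      refine ⟨?_, ?_, ?_, ?_⟩
      · intro j
        by_cases hx : ∃ p ∈ C, ENNReal.ofReal 0 < p.1.1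
        · obtain ⟨p, hp, hpt⟩ := hx
          rw [hagree p hp j 0 hpt, p.2.zero]
        · exact dif_neg hx
      · intro j t h0 ht
        obtain ⟨p, hp, hpt⟩ := hσ t ht
        rw [hHag p hp j t hpt]
        exact p.2.nonneg j t h0 hpt
      · intro j t h0 ht
        obtain ⟨p, hp, hpt⟩ := hσ t ht
        rw [hHag p hp j t hpt]
        refine (p.2.deriv j t h0 hpt).congr_of_eventuallyEq ?_ (hagree p hp j t hpt)
        have : ∀ᶠ s in 𝓝 t, ENNReal.ofReal s < p.1.1 :=
          ENNReal.continuous_ofReal.continuousAt.eventually (gt_mem_nhds hpt)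
        filter_upwards [mem_nhdsWithin_of_mem_nhds this] with s hs
        exact hagree p hp j s hs
      · intro j t h0 ht
        obtain ⟨p, hp, hpt⟩ := hσ t ht
        exact (p.2.cont j t h0 hpt).congr
          (fun s hs => hagree p hp j s ((ENNReal.ofReal_le_ofReal hs.2).trans_lt hpt))
          (hagree p hp j t hpt)
    refine ⟨⟨(σ, d), hgood⟩, fun p hp => ⟨?_, fun j t ht => hagree p hp j t ht⟩⟩
    exact le_iSup₂ (f := fun (p : P) (_ : p ∈ C) => p.1.1) p hp
  · intro a b c hab hbc
    exact ⟨hab.1.trans hbc.1, fun j t ht =>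
      (hbc.2 j t (ht.trans_le hab.1)).trans (hab.2 j t ht)⟩

end good

/-- existence for piecewise constant off-diagonal data. -/
theorem stmt1 (m : ℕ) (hm : 1 ≤ m)
    (f : Fin m → Fin m → ℝ → ℝ) (g : Fin m → ℝ → ℝ)
    (hH : HypH m f g)
    (hpc_f : ∀ i j, i ≠ j → PiecewiseConst (f i j))
    (hpc_g : ∀ j, PiecewiseConst (g j)) :
    ∃ τ : ℝ≥0∞, 0 < τ ∧ ∃ h : Fin m → ℝ → ℝ,
      IsSolutionOn m f g τ h ∧ NonnegOn m τ h ∧ (τ < ⊤ → ExplodesAt m τ h) := by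
  obtain ⟨τ, c, hc, hmax⟩ := aux_maximal m f g
  have hpr : ∀ j t, 0 ≤ t → ENNReal.ofReal t < τ → prim (auxH m f g c j) t = c j t :=
    fun j t h0 ht => hc.prim_eq j t h0 ht
  have hext : τ < ⊤ → ¬ ∀ j, ∃ M, ∀ t, 0 ≤ t → ENNReal.ofReal t < τ → c j t ≤ M := by
    intro hτ hb
    have hT : ENNReal.ofReal τ.toReal = τ := ENNReal.ofReal_toReal hτ.ne
    have hc' := hc
    rw [← hT] at hc'
    obtain ⟨τ', c', hlt, hg, heq⟩ := AuxGood.extend hH hpc_f hpc_g τ.toReal ENNReal.toReal_nonneg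
      hc' (fun j => by
        obtain ⟨M, hM⟩ := hb j
        refine ⟨M, fun t h0 ht => hM t h0 ?_⟩
        rw [← hT]
        exact (ENNReal.ofReal_lt_ofReal_iff (h0.trans_lt ht)).2 ht)
    rw [hT] at hlt heq
    exact absurd (hmax τ' c' hg hlt.le heq) (not_le.2 hlt)
  have hτ0 : 0 < τ := by
    rw [pos_iff_ne_zero]
    intro h0
    refine hext (by rw [h0]; exact ENNReal.zero_lt_top) fun j => ⟨0, fun t _ ht => ?_⟩
    rw [h0] at ht
    exact absurd ht not_lt_zero
  refine ⟨τ, hτ0, auxH m f g c, ⟨fun j => ⟨?_, ?_⟩, ?_⟩, ?_, ?_⟩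
  · intro t h0 ht
    have hc0 : ∀ i, 0 ≤ c i t := fun i => by
      rw [← hc.zero i]
      exact hc.mono i 0 t le_rfl h0 ht
    refine Tendsto.add (tendsto_finsetSum _ fun i _ => ?_)
      ((hH.cadlag_g j).1 t h0 (by simp))
    have hci : ContinuousWithinAt (f i j) (Ici (c i t)) (c i t) :=
      continuousWithinAt_Ioi_iff_Ici.1 ((hH.cadlag_f i j).1 (c i t) (hc0 i) (by simp))
    refine hci.tendsto.comp ?_
    refine tendsto_nhdsWithin_of_tendsto_nhds_of_eventually_within _
      ((hc.deriv i t h0 ht).continuousWithinAt.mono Ioi_subset_Ici_self).tendsto ?_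
    have : ∀ᶠ s in 𝓝 t, ENNReal.ofReal s < τ :=
      ENNReal.continuous_ofReal.continuousAt.eventually (gt_mem_nhds ht)
    filter_upwards [self_mem_nhdsWithin, mem_nhdsWithin_of_mem_nhds this] with s hs hsτ
    exact hc.mono i t s h0 (le_of_lt hs) hsτ
  · intro t h0 ht
    have hlim : ∀ i, Tendsto (c i) (𝓝[<] t) (𝓝 (c i t)) := by
      intro i
      refine (hc.cont i t h0.le ht).tendsto.mono_left ?_
      rw [← nhdsWithin_Ioo_eq_nhdsLT h0]
      exact nhdsWithin_mono _ Ioo_subset_Icc_self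
    obtain ⟨l, -, hl⟩ := hc.leftlim hH t h0 ht.le (fun i => c i t) hlim j
    exact ⟨l, hl⟩
  · intro j t h0 ht
    simp only [hpr _ t h0 ht]
    rfl
  · intro j t h0 ht
    exact hc.nonneg j t h0 ht
  · intro hτ
    by_contra hne
    refine hext hτ fun j => ?_
    unfold ExplodesAt at hne
    push Not at hne
    obtain ⟨M, hM⟩ := hne j
    refine ⟨M, fun t h0 ht => ?_⟩
    rw [← hpr j t h0 ht]
    exact (hM t h0 ht).le
end
end

section
/- Let (f^{i,j}, g^j) (1 ≤ i,j ≤ m) satisfy hypotheses (H). Then there exist τ ∈ (0,∞] and a non-negative solution h of the time-change system on [0,τ), with primitive c^j(t) = ∫_0^t h^j(s) ds, such that: (1) if τ < ∞ then c^j(τ−) = ∞ for some j (the solution explodes at τ); and (2) the solution is maximal: if h̃ is any non-negative solution of the time-change system on some interval [0,τ̃), with primitive c̃, then c̃^j(t) ≤ c^j(t) for all j and all t < min(τ, τ̃). -/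
open MeasureTheory Filter Function Set
open scoped ENNReal Topology

noncomputable section

structure Reg (φ : ℝ → ℝ) : Prop where
  bdd : ∃ K, ∀ x, φ x ≤ K
  usc : UpperSemicontinuous φ
  rc : ∀ x, ContinuousWithinAt φ (Set.Ici x) x

lemma Reg.approx {φ : ℝ → ℝ} (h : Reg φ) : ∃ ψ : ℕ → ℝ → ℝ,
    (∃ K, ∀ n x, ψ n x ≤ K) ∧ (∀ n x y, |ψ n x - ψ n y| ≤ ((n:ℝ)+1) * |x - y|) ∧
    (∀ n x, φ x ≤ ψ n x) ∧ (∀ x, Antitone (fun n => ψ n x)) ∧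
    (Monotone φ → ∀ n, Monotone (ψ n)) ∧
    (∀ x : ℝ, ∀ xn : ℕ → ℝ, Tendsto xn atTop (𝓝 x) → (∀ n, x ≤ xn n) →
      Tendsto (fun n => ψ n (xn n)) atTop (𝓝 (φ x))) := by
  obtain ⟨K, hK⟩ := h.bdd
  have hb : ∀ (n : ℕ) (x : ℝ), BddAbove (Set.range fun y => φ y - ((n:ℝ)+1) * |x - y|) := by
    intro n x
    refine ⟨K, ?_⟩
    rintro _ ⟨y, rfl⟩
    have : 0 ≤ ((n:ℝ)+1) * |x - y| := by positivity
    have := hK y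
    linarith
  have hlow : ∀ (n : ℕ) (x : ℝ), φ x ≤ ⨆ y, (φ y - ((n:ℝ)+1) * |x - y|) := by
    intro n x
    have := le_ciSup (hb n x) x
    simpa using this
  refine ⟨fun n x => ⨆ y, (φ y - ((n:ℝ)+1) * |x - y|), ⟨K, ?_⟩, ?_, hlow, ?_, ?_, ?_⟩
  · intro n x
    refine ciSup_le fun y => ?_
    have : 0 ≤ ((n:ℝ)+1) * |x - y| := by positivity
    have := hK y
    linarith
  · intro n x y
    have key : ∀ x y : ℝ, (⨆ z, (φ z - ((n:ℝ)+1) * |x - z|)) ≤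
        (⨆ z, (φ z - ((n:ℝ)+1) * |y - z|)) + ((n:ℝ)+1) * |x - y| := by
      intro x y
      refine ciSup_le fun z => ?_
      have h1 := le_ciSup (hb n y) z
      have h2 : |y - z| ≤ |x - y| + |x - z| := by
        have := abs_sub_le y x z
        rwa [abs_sub_comm y x] at this
      have h3 : ((n:ℝ)+1) * |y - z| ≤ ((n:ℝ)+1) * (|x - y| + |x - z|) :=
        mul_le_mul_of_nonneg_left h2 (by positivity)
      linarith
    rw [abs_le]
    have h1 := key x y
    have h2 := key y x
    rw [abs_sub_comm y x] at h2
    constructor <;> linarith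
  · intro x a b hab
    refine ciSup_mono (hb a x) fun y => ?_
    have : (a:ℝ) ≤ b := by exact_mod_cast hab
    have := abs_nonneg (x - y)
    nlinarith
  · intro hm n x y hxy
    refine ciSup_le fun z => ?_
    have h1 := le_ciSup (hb n y) (z + (y - x))
    have h2 : φ z ≤ φ (z + (y - x)) := hm (by linarith)
    have h3 : y - (z + (y - x)) = x - z := by ring
    rw [h3] at h1
    linarith
  · intro x xn hx hge
    rw [tendsto_order]
    constructor
    · intro a ha
      have h1 : Tendsto xn atTop (𝓝[≥] x) :=
        tendsto_nhdsWithin_iff.2 ⟨hx, Eventually.of_forall hge⟩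
      have h2 : Tendsto (fun n => φ (xn n)) atTop (𝓝 (φ x)) := (h.rc x).tendsto.comp h1
      filter_upwards [h2.eventually (lt_mem_nhds ha)] with n hn
      exact lt_of_lt_of_le hn (hlow n _)
    · intro a ha
      obtain ⟨b, hb1, hb2⟩ := exists_between ha
      have h1 := h.usc x b hb1
      obtain ⟨δ, hδ, hδ'⟩ := Metric.eventually_nhds_iff.1 h1
      have h2 : ∀ᶠ n in atTop, |xn n - x| < δ / 2 := by
        have := Metric.tendsto_nhds.1 hx (δ/2) (by positivity)
        simpa [Real.dist_eq] using this
      have h3 : ∀ᶠ n : ℕ in atTop, (K - b) / (δ / 2) ≤ (n:ℝ) :=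
        tendsto_natCast_atTop_atTop.eventually_ge_atTop _
      filter_upwards [h2, h3] with n hn1 hn2
      refine lt_of_le_of_lt (ciSup_le fun y => ?_) hb2
      by_cases hy : |y - x| < δ
      · have h4 : φ y < b := hδ' (by simpa [Real.dist_eq] using hy)
        have : 0 ≤ ((n:ℝ)+1) * |xn n - y| := by positivity
        linarith
      · push Not at hy
        have h5 : δ / 2 ≤ |xn n - y| := by
          have := abs_sub_le y (xn n) x
          rw [abs_sub_comm y (xn n)] at this
          linarith
        rw [div_le_iff₀ (by positivity)] at hn2
        have h6 : ((n:ℝ)+1) * (δ/2) ≤ ((n:ℝ)+1) * |xn n - y| :=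
          mul_le_mul_of_nonneg_left h5 (by positivity)
        have := hK y
        nlinarith

lemma compare {m : ℕ} {T : ℝ} (u v : Fin m → ℝ → ℝ) (A B : Fin m → (Fin m → ℝ) → ℝ → ℝ)
    (hA : ∀ j, Continuous (fun p : (Fin m → ℝ) × ℝ => A j p.1 p.2))
    (hB : ∀ j, Continuous (fun p : (Fin m → ℝ) × ℝ => B j p.1 p.2))
    (hu : ∀ j, ContinuousOn (u j) (Set.Icc 0 T)) (hv : ∀ j, ContinuousOn (v j) (Set.Icc 0 T))
    (h0 : ∀ j, u j 0 ≤ v j 0)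
    (hAu : ∀ j s t, 0 ≤ s → s ≤ t → t ≤ T → u j t - u j s ≤ ∫ r in s..t, A j (fun i => u i r) r)
    (hBv : ∀ j s t, 0 ≤ s → s ≤ t → t ≤ T → ∫ r in s..t, B j (fun i => v i r) r ≤ v j t - v j s)
    (hAB : ∀ j x y t, (∀ i, x i ≤ y i) → x j = y j → A j x t < B j y t) :
    ∀ j, ∀ t ∈ Set.Icc 0 T, u j t ≤ v j t := by
  have cA : ∀ j, ContinuousOn (fun r => A j (fun i => u i r) r) (Set.Icc 0 T) := fun j =>
    (hA j).comp_continuousOn ((continuousOn_pi.2 hu).prodMk continuousOn_id)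
  have cB : ∀ j, ContinuousOn (fun r => B j (fun i => v i r) r) (Set.Icc 0 T) := fun j =>
    (hB j).comp_continuousOn ((continuousOn_pi.2 hv).prodMk continuousOn_id)
  have main : Set.Icc 0 T ⊆ {t | ∀ j, u j t ≤ v j t} := by
    refine IsClosed.Icc_subset_of_forall_mem_nhdsWithin ?_ h0 ?_
    · have : {t | ∀ j, u j t ≤ v j t} ∩ Set.Icc 0 T =
          Set.Icc 0 T ∩ ⋂ j, {t ∈ Set.Icc 0 T | u j t ≤ v j t} := by
        ext t
        simp only [Set.mem_inter_iff, Set.mem_ofPred_eq, Set.mem_iInter]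
        exact ⟨fun h => ⟨h.2, fun i => ⟨h.2, h.1 i⟩⟩, fun h => ⟨fun i => (h.2 i).2, h.1⟩⟩
      rw [this]
      exact isClosed_Icc.inter (isClosed_iInter fun j => isClosed_Icc.isClosed_le (hu j) (hv j))
    · rintro x ⟨hx, hx0, hxT⟩
      have hsub : 𝓝[>] x ≤ 𝓝[Set.Icc 0 T] x := by
        rw [← nhdsWithin_Ioc_eq_nhdsGT hxT]
        exact nhdsWithin_mono _ fun y hy => ⟨hx0.trans hy.1.le, hy.2⟩
      have hsub2 : 𝓝[≥] x ≤ 𝓝[Set.Icc 0 T] x := by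
        rw [← nhdsWithin_Icc_eq_nhdsGE hxT]
        exact nhdsWithin_mono _ fun y hy => ⟨hx0.trans hy.1, hy.2⟩
      have hxm : x ∈ Set.Icc 0 T := ⟨hx0, hxT.le⟩
      refine eventually_all.2 fun j => ?_
      rcases (hx j).lt_or_eq with hlt | heq
      · have := ((hu j x hxm).prodMk (hv j x hxm)).eventually
          (isOpen_lt continuous_fst continuous_snd |>.mem_nhds hlt)
        filter_upwards [hsub this] with y hy using le_of_lt hy
      · have hlt := hAB j (fun i => u i x) (fun i => v i x) x hx heq
        have := ((cA j x hxm).prodMk (cB j x hxm)).eventually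
          (isOpen_lt continuous_fst continuous_snd |>.mem_nhds hlt)
        have h1 := hsub2 this
        obtain ⟨w, hw, hw'⟩ := mem_nhdsGE_iff_exists_Icc_subset.1 h1
        have h2 : ∀ᶠ y in 𝓝[>] x, y ∈ Set.Ioc x (min w T) :=
          Ioc_mem_nhdsGT (lt_min hw hxT)
        filter_upwards [h2] with y hy
        have hyw : y ≤ w := hy.2.trans (min_le_left _ _)
        have hyT : y ≤ T := hy.2.trans (min_le_right _ _)
        have hss : Set.Icc x y ⊆ Set.Icc 0 T := fun z hz => ⟨hx0.trans hz.1, hz.2.trans hyT⟩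
        have h3 : ∫ r in x..y, A j (fun i => u i r) r ≤ ∫ r in x..y, B j (fun i => v i r) r := by
          refine intervalIntegral.integral_mono_on hy.1.le ?_ ?_ ?_
          · exact ((cA j).mono hss).intervalIntegrable_of_Icc hy.1.le
          · exact ((cB j).mono hss).intervalIntegrable_of_Icc hy.1.le
          · intro r hr
            exact le_of_lt (hw' ⟨hr.1, hr.2.trans hyw⟩)
        have h4 := hAu j x y hx0 hy.1.le hyT
        have h5 := hBv j x y hx0 hy.1.le hyT
        linarith
  exact fun j t ht => main ht j

/-- Global solution on `[0,T]` for a bounded Lipschitz field. -/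
lemma ode_exists {m : ℕ} {T : ℝ} (hT : 0 ≤ T) (B : Fin m → (Fin m → ℝ) → ℝ → ℝ)
    (hB : ∀ j, Continuous (fun p : (Fin m → ℝ) × ℝ => B j p.1 p.2))
    (L : ℝ) (hL : 0 ≤ L) (hBL : ∀ j x t, |B j x t| ≤ L)
    (M : ℝ) (hM : 0 ≤ M) (hBM : ∀ j x y t, |B j x t - B j y t| ≤ M * ‖x - y‖) :
    ∃ v : Fin m → ℝ → ℝ, (∀ j, Continuous (v j)) ∧
      ∀ j, ∀ t ∈ Set.Icc 0 T, v j t = ∫ r in (0:ℝ)..t, B j (fun i => v i r) r := by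
  lift L to NNReal using hL
  lift M to NNReal using hM
  have hP : IsPicardLindelof (fun t (x : Fin m → ℝ) j => B j x t)
      (tmin := 0) (tmax := T) ⟨0, ⟨le_rfl, hT⟩⟩ (0 : Fin m → ℝ) (L * ⟨T, hT⟩) 0 L M := by
    constructor
    · intro t _
      refine LipschitzWith.lipschitzOnWith (LipschitzWith.of_dist_le_mul fun x y => ?_)
      rw [dist_eq_norm, dist_eq_norm, pi_norm_le_iff_of_nonneg (by positivity)]
      intro j
      simpa using hBM j x y t
    · intro x _
      refine (continuous_pi fun j => ?_).continuousOn
      exact (hB j).comp (continuous_const.prodMk continuous_id)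
    · intro t _ x _
      rw [pi_norm_le_iff_of_nonneg (by positivity)]
      intro j
      simpa using hBL j x t
    · simp [hT]
      rfl
  obtain ⟨α, h0, hα⟩ := hP.exists_eq_forall_mem_Icc_hasDerivWithinAt₀
  have hc : ContinuousOn α (Set.Icc 0 T) := fun t ht => (hα t ht).continuousWithinAt
  have hcj : ∀ j, ContinuousOn (fun t => α t j) (Set.Icc 0 T) := fun j =>
    (continuous_apply j).comp_continuousOn hc
  refine ⟨fun j t => α (max 0 (min t T)) j, ?_, ?_⟩
  · intro j
    have h1 : Continuous fun t : ℝ => max 0 (min t T) := by fun_prop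
    exact (hcj j).comp_continuous h1 fun t => ⟨le_max_left _ _, max_le hT (min_le_right _ _)⟩
  · intro j t ht
    have hcl : ∀ r ∈ Set.Icc 0 T, max 0 (min r T) = r := fun r hr => by
      rw [min_eq_left hr.2, max_eq_right hr.1]
    have hc2 : ContinuousOn (fun r => B j (α r) r) (Set.Icc 0 T) :=
      (hB j).comp_continuousOn (hc.prodMk continuousOn_id)
    have hss : Set.Icc 0 t ⊆ Set.Icc 0 T := Set.Icc_subset_Icc_right ht.2
    have h1 : ∫ r in (0:ℝ)..t, B j (α r) r = α t j - α 0 j := by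
      refine intervalIntegral.integral_eq_sub_of_hasDerivAt_of_le ht.1 ((hcj j).mono hss) ?_
        ((hc2.mono hss).intervalIntegrable_of_Icc ht.1)
      intro x hx
      have h2 := (hα x ⟨hx.1.le, hx.2.le.trans ht.2⟩).hasDerivAt
        (Icc_mem_nhds hx.1 (hx.2.trans_le ht.2))
      exact hasDerivAt_pi.1 h2 j
    simp only [hcl t ht]
    have h00 : α 0 j = 0 := by
      have := congrFun h0 j
      simpa using this
    rw [h00, sub_zero] at h1
    rw [← h1]
    refine intervalIntegral.integral_congr fun r hr => ?_
    rw [Set.uIcc_of_le ht.1] at hr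
    simp only [hcl r (hss hr)]

lemma prim_facts {S : ℝ} (hS : 0 ≤ S) {c p : ℝ → ℝ} (hpint : IntervalIntegrable p volume 0 S)
    (hc : ∀ t ∈ Set.Icc 0 S, c t = ∫ r in (0:ℝ)..t, p r) :
    ContinuousOn c (Set.Icc 0 S) ∧ ∀ s t, 0 ≤ s → s ≤ t → t ≤ S →
      IntervalIntegrable p volume s t ∧ c t - c s = ∫ r in s..t, p r := by
  have hsub : ∀ s t, 0 ≤ s → s ≤ t → t ≤ S → IntervalIntegrable p volume s t := by
    intro s t hs hst ht
    refine hpint.mono_set ?_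
    rw [Set.uIcc_of_le hst, Set.uIcc_of_le hS]
    exact Set.Icc_subset_Icc hs ht
  constructor
  · have h1 := intervalIntegral.continuousOn_primitive_interval' hpint (Set.left_mem_uIcc)
    rw [Set.uIcc_of_le hS] at h1
    exact h1.congr hc
  · intro s t hs hst ht
    refine ⟨hsub s t hs hst ht, ?_⟩
    rw [hc t ⟨hs.trans hst, ht⟩, hc s ⟨hs, hst.trans ht⟩]
    exact intervalIntegral.integral_interval_sub_left (hsub 0 t le_rfl (hs.trans hst) ht)
      (hsub 0 s le_rfl hs (hst.trans ht))

def Sol {m : ℕ} (f : Fin m → Fin m → ℝ → ℝ) (g : Fin m → ℝ → ℝ) (S : ℝ)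
    (u : Fin m → ℝ → ℝ) : Prop :=
  ∀ j, IntervalIntegrable (fun s => (∑ i, f i j (u i s)) + g j s) volume 0 S ∧
    ∀ t ∈ Set.Icc 0 S, u j t = ∫ s in (0:ℝ)..t, ((∑ i, f i j (u i s)) + g j s)

/-- maximal solution of the equation with positive part -/
lemma core_pos {m : ℕ} {T : ℝ} (hT : 0 ≤ T) (f : Fin m → Fin m → ℝ → ℝ) (g : Fin m → ℝ → ℝ)
    (hf : ∀ i j, Reg (f i j)) (hg : ∀ j, Reg (g j))
    (hmf : ∀ i j, i ≠ j → Monotone (f i j)) :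
    ∃ c : Fin m → ℝ → ℝ,
      (∀ j, IntervalIntegrable (fun s => max ((∑ i, f i j (c i s)) + g j s) 0) volume 0 T ∧
        ∀ t ∈ Set.Icc 0 T, c j t = ∫ s in (0:ℝ)..t, max ((∑ i, f i j (c i s)) + g j s) 0) ∧
      ∀ S ∈ Set.Icc 0 T, ∀ u, Sol f g S u → ∀ j, ∀ t ∈ Set.Icc 0 S, u j t ≤ c j t := by
  choose ψ hψK hψL hψf hψanti hψmono hψlim using fun i j => (hf i j).approx
  choose γ hγK hγL hγf hγanti hγmono hγlim using fun j => (hg j).approx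
  choose K hK using hψK
  choose Kg hKg using hγK
  have cψ : ∀ i j n, Continuous (ψ i j n) := by
    intro i j n
    refine (LipschitzWith.of_dist_le_mul (K := (n:NNReal)+1) fun x y => ?_).continuous
    simpa [Real.dist_eq] using hψL i j n x y
  have cγ : ∀ j n, Continuous (γ j n) := by
    intro j n
    refine (LipschitzWith.of_dist_le_mul (K := (n:NNReal)+1) fun x y => ?_).continuous
    simpa [Real.dist_eq] using hγL j n x y
  let A : ℕ → Fin m → (Fin m → ℝ) → ℝ → ℝ := fun n j x t =>
    max ((∑ i, ψ i j n (x i)) + γ j n t) 0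
  let B : ℕ → Fin m → (Fin m → ℝ) → ℝ → ℝ := fun n j x t => A n j x t + 1 / ((n:ℝ)+1)
  have cA : ∀ n j, Continuous (fun p : (Fin m → ℝ) × ℝ => A n j p.1 p.2) := by
    intro n j
    refine Continuous.max (Continuous.add ?_ ((cγ j n).comp continuous_snd)) continuous_const
    exact continuous_finsetSum _ fun i _ =>
      (cψ i j n).comp ((continuous_apply i).comp continuous_fst)
  have cB : ∀ n j, Continuous (fun p : (Fin m → ℝ) × ℝ => B n j p.1 p.2) := by
    intro n j
    exact (cA n j).add continuous_const
  set L : ℝ := (∑ j, ((∑ i, |K i j|) + |Kg j|)) + 1 with hLdef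
  have hS0 : ∀ j, 0 ≤ (∑ i, |K i j|) + |Kg j| := fun j => by positivity
  have hL : 0 ≤ L := by positivity
  have hA0 : ∀ n j x t, 0 ≤ A n j x t := fun n j x t => le_max_right _ _
  have hn1 : ∀ n : ℕ, (0:ℝ) < 1 / ((n:ℝ)+1) ∧ 1 / ((n:ℝ)+1) ≤ 1 := by
    intro n
    refine ⟨by positivity, ?_⟩
    rw [div_le_one (by positivity)]
    linarith [(Nat.cast_nonneg n : (0:ℝ) ≤ n)]
  have hAL : ∀ n j x t, A n j x t ≤ L - 1 := by
    intro n j x t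
    have h1 : (∑ i, |K i j|) + |Kg j| ≤ L - 1 := by
      have := Finset.single_le_sum (f := fun j => (∑ i, |K i j|) + |Kg j|)
        (fun j _ => hS0 j) (Finset.mem_univ j)
      simp only [hLdef]
      linarith
    refine max_le (le_trans (add_le_add (Finset.sum_le_sum fun i _ => ?_) ?_) h1) ((hS0 j).trans h1)
    · exact (hK i j n _).trans (le_abs_self _)
    · exact (hKg j n _).trans (le_abs_self _)
  have hB0 : ∀ n j x t, 0 ≤ B n j x t := fun n j x t => add_nonneg (hA0 _ _ _ _) (hn1 n).1.le
  have hBL : ∀ n j x t, |B n j x t| ≤ L := by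
    intro n j x t
    rw [abs_of_nonneg (hB0 n j x t)]
    have h1 := hAL n j x t
    have h2 := (hn1 n).2
    simp only [B]
    linarith
  have hBM : ∀ n j x y t, |B n j x t - B n j y t| ≤ (m * ((n:ℝ)+1)) * ‖x - y‖ := by
    intro n j x y t
    have h1 : B n j x t - B n j y t = max ((∑ i, ψ i j n (x i)) + γ j n t) 0
        - max ((∑ i, ψ i j n (y i)) + γ j n t) 0 := by simp only [B, A]; ring
    rw [h1]
    refine (abs_max_sub_max_le_abs _ _ _).trans ?_
    rw [add_sub_add_right_eq_sub, ← Finset.sum_sub_distrib]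
    refine (Finset.abs_sum_le_sum_abs _ _).trans ?_
    have h2 : ∀ i ∈ Finset.univ, |ψ i j n (x i) - ψ i j n (y i)| ≤ ((n:ℝ)+1) * ‖x - y‖ := by
      intro i _
      refine (hψL i j n _ _).trans (mul_le_mul_of_nonneg_left ?_ (by positivity))
      simpa using norm_le_pi_norm (x - y) i
    refine (Finset.sum_le_sum h2).trans ?_
    simp [mul_assoc]
  choose w hwc hw using fun n : ℕ =>
    ode_exists hT (B n) (cB n) L hL (hBL n) (m * ((n:ℝ)+1)) (by positivity) (hBM n)
  have cBw : ∀ n j, Continuous (fun r => B n j (fun i => w n i r) r) := fun n j =>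
    (cB n j).comp ((continuous_pi fun i => hwc n i).prodMk continuous_id)
  have hwsub : ∀ n j s t, 0 ≤ s → s ≤ t → t ≤ T →
      w n j t - w n j s = ∫ r in s..t, B n j (fun i => w n i r) r := by
    intro n j s t hs hst ht
    exact ((prim_facts hT ((cBw n j).intervalIntegrable 0 T) (hw n j)).2 s t hs hst ht).2
  have hsumle : ∀ k n j x y t, n ≤ k → (∀ i, x i ≤ y i) → x j = y j →
      A k j x t ≤ A n j y t := by
    intro k n j x y t hnk hxy hj
    refine max_le_max (add_le_add (Finset.sum_le_sum fun i _ => ?_) (hγanti j t hnk)) le_rfl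
    refine (hψanti i j (x i) hnk).trans ?_
    by_cases hij : i = j
    · subst hij
      rw [hj]
    · exact hψmono i j (hmf i j hij) n (hxy i)
  have hw0 : ∀ n j, w n j 0 = 0 := fun n j => by
    rw [hw n j 0 ⟨le_rfl, hT⟩, intervalIntegral.integral_same]
  have hanti : ∀ j, ∀ t ∈ Set.Icc 0 T, Antitone (fun n => w n j t) := by
    intro j t ht
    refine antitone_nat_of_succ_le fun n => ?_
    refine compare (w (n+1)) (w n) (B (n+1)) (B n) (cB _) (cB _) (fun j => (hwc _ j).continuousOn)
      (fun j => (hwc _ j).continuousOn) (fun j => by rw [hw0, hw0])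
      (fun j s t hs hst ht => (hwsub (n+1) j s t hs hst ht).le)
      (fun j s t hs hst ht => (hwsub n j s t hs hst ht).ge) ?_ j t ht
    intro j x y t hxy hj
    refine add_lt_add_of_le_of_lt (hsumle (n+1) n j x y t (Nat.le_succ n) hxy hj) ?_
    push_cast
    apply one_div_lt_one_div_of_lt
    · positivity
    · linarith
  have hwnn : ∀ n j, ∀ t ∈ Set.Icc 0 T, 0 ≤ w n j t := by
    intro n j t ht
    rw [hw n j t ht]
    exact intervalIntegral.integral_nonneg ht.1 fun r _ => hB0 _ _ _ _
  have hbdd : ∀ j, ∀ t ∈ Set.Icc 0 T, BddBelow (Set.range fun n => w n j t) := by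
    intro j t ht
    refine ⟨0, ?_⟩
    rintro _ ⟨n, rfl⟩
    exact hwnn n j t ht
  let c : Fin m → ℝ → ℝ := fun j t => ⨅ n, w n j t
  have hclim : ∀ j, ∀ t ∈ Set.Icc 0 T, Tendsto (fun n => w n j t) atTop (𝓝 (c j t)) :=
    fun j t ht => tendsto_atTop_ciInf (hanti j t ht) (hbdd j t ht)
  have hcle : ∀ j, ∀ t ∈ Set.Icc 0 T, ∀ n, c j t ≤ w n j t := fun j t ht n =>
    ciInf_le (hbdd j t ht) n
  have hBlim : ∀ j, ∀ t ∈ Set.Icc 0 T, Tendsto (fun n => B n j (fun i => w n i t) t) atTop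
      (𝓝 (max ((∑ i, f i j (c i t)) + g j t) 0)) := by
    intro j t ht
    have h1 : Tendsto (fun n => (∑ i, ψ i j n (w n i t)) + γ j n t) atTop
        (𝓝 ((∑ i, f i j (c i t)) + g j t)) := by
      refine Tendsto.add (tendsto_finsetSum _ fun i _ => ?_) ?_
      · exact hψlim i j (c i t) (fun n => w n i t) (hclim i t ht) (hcle i t ht)
      · exact hγlim j t (fun _ => t) tendsto_const_nhds (fun _ => le_rfl)
    have h2 := (h1.max (tendsto_const_nhds (x := (0:ℝ)))).add
      (tendsto_one_div_add_atTop_nhds_zero_nat (𝕜 := ℝ))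
    rw [add_zero] at h2
    exact h2
  refine ⟨c, ?_, ?_⟩
  · intro j
    have hI : IntervalIntegrable (fun s => max ((∑ i, f i j (c i s)) + g j s) 0) volume 0 T := by
      refine IntervalIntegrable.mono_fun' (g := fun _ => L) intervalIntegrable_const ?_ ?_
      · refine aestronglyMeasurable_of_tendsto_ae atTop
          (f := fun n r => B n j (fun i => w n i r) r)
          (fun n => (cBw n j).aestronglyMeasurable) ?_
        refine ae_restrict_of_forall_mem measurableSet_uIoc fun r hr => ?_
        rw [Set.uIoc_of_le hT] at hr
        exact hBlim j r ⟨hr.1.le, hr.2⟩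
      · refine ae_restrict_of_forall_mem measurableSet_uIoc fun r hr => ?_
        rw [Set.uIoc_of_le hT] at hr
        refine le_of_tendsto (hBlim j r ⟨hr.1.le, hr.2⟩).norm (Eventually.of_forall fun n => ?_)
        exact hBL _ _ _ _
    refine ⟨hI, fun t ht => ?_⟩
    refine tendsto_nhds_unique (hclim j t ht) ?_
    have h1 : (fun n => w n j t) = fun n => ∫ r in (0:ℝ)..t, B n j (fun i => w n i r) r := by
      funext n
      exact hw n j t ht
    rw [h1]
    refine intervalIntegral.tendsto_integral_filter_of_dominated_convergence (fun _ => L) ?_ ?_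
      intervalIntegrable_const ?_
    · exact Eventually.of_forall fun n => (cBw n j).aestronglyMeasurable
    · exact Eventually.of_forall fun n => Eventually.of_forall fun r _ => hBL _ _ _ _
    · refine Eventually.of_forall fun r hr => ?_
      rw [Set.uIoc_of_le ht.1] at hr
      exact hBlim j r ⟨hr.1.le, hr.2.trans ht.2⟩
  · intro S hS u hu j t ht
    refine le_ciInf fun n => ?_
    have hpf := fun j => prim_facts hS.1 (hu j).1 (hu j).2
    have huc : ∀ j, ContinuousOn (u j) (Set.Icc 0 S) := fun j => (hpf j).1
    refine compare u (w n) (A n) (B n) (cA _) (cB _) huc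
      (fun j => (hwc _ j).continuousOn) (fun j => ?_) ?_
      (fun j s t hs hst ht => (hwsub n j s t hs hst (ht.trans hS.2)).ge) ?_ j t ht
    · rw [hw0, (hu j).2 0 ⟨le_rfl, hS.1⟩, intervalIntegral.integral_same]
    · intro j s t hs hst ht
      obtain ⟨hi, he⟩ := (hpf j).2 s t hs hst ht
      rw [he]
      refine intervalIntegral.integral_mono_on hst hi ?_ ?_
      · refine ContinuousOn.intervalIntegrable_of_Icc hst ?_
        refine ContinuousOn.mono ?_ (Set.Icc_subset_Icc hs ht)
        exact (cA n j).comp_continuousOn ((continuousOn_pi.2 huc).prodMk continuousOn_id)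
      · intro r _
        refine le_trans ?_ (le_max_left _ _)
        exact add_le_add (Finset.sum_le_sum fun i _ => hψf i j n _) (hγf j n r)
    · intro j x y t hxy hj
      have := hsumle n n j x y t le_rfl hxy hj
      exact lt_of_le_of_lt this (lt_add_of_pos_right _ (hn1 n).1)

lemma core {m : ℕ} {T : ℝ} (hT : 0 ≤ T) (f : Fin m → Fin m → ℝ → ℝ) (g : Fin m → ℝ → ℝ)
    (hf : ∀ i j, Reg (f i j)) (hg : ∀ j, Reg (g j))
    (hmf : ∀ i j, i ≠ j → Monotone (f i j)) (hmg : ∀ j, Monotone (g j))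
    (h0 : ∀ j, 0 ≤ (∑ i, f i j 0) + g j 0) :
    ∃ c : Fin m → ℝ → ℝ, Sol f g T c ∧
      (∀ j, ∀ t ∈ Set.Icc 0 T, 0 ≤ (∑ i, f i j (c i t)) + g j t) ∧
      ∀ S ∈ Set.Icc 0 T, ∀ u, Sol f g S u → ∀ j, ∀ t ∈ Set.Icc 0 S, u j t ≤ c j t := by
  obtain ⟨c, hc, hmax⟩ := core_pos hT f g hf hg hmf
  have hpf := fun j => prim_facts hT (hc j).1 (hc j).2
  have hmono : ∀ j s t, 0 ≤ s → s ≤ t → t ≤ T → c j s ≤ c j t := by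
    intro j s t hs hst ht
    have h1 := ((hpf j).2 s t hs hst ht).2
    have h2 : 0 ≤ ∫ r in s..t, max ((∑ i, f i j (c i r)) + g j r) 0 :=
      intervalIntegral.integral_nonneg hst fun r _ => le_max_right _ _
    linarith
  have hc0 : ∀ j, c j 0 = 0 := fun j => by
    rw [(hc j).2 0 ⟨le_rfl, hT⟩, intervalIntegral.integral_same]
  have hnn : ∀ j, ∀ t ∈ Set.Icc 0 T, 0 ≤ (∑ i, f i j (c i t)) + g j t := by
    intro j t ht
    by_contra hneg
    push Not at hneg
    have husc : UpperSemicontinuousOn (fun r => (∑ i, f i j (c i r)) + g j r) (Set.Icc 0 t) := by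
      refine UpperSemicontinuousOn.add ?_ ((hg j).usc.upperSemicontinuousOn _)
      refine upperSemicontinuousOn_sum fun i _ => ?_
      exact ((hf i j).usc.upperSemicontinuousOn Set.univ).comp
        ((hpf i).1.mono (Set.Icc_subset_Icc_right ht.2)) (fun _ _ => Set.mem_univ _)
    let Z : Set ℝ := {r ∈ Set.Icc 0 t | 0 ≤ (∑ i, f i j (c i r)) + g j r}
    have hZc : IsClosed Z := by
      rw [← isOpen_compl_iff, isOpen_iff_mem_nhds]
      intro x hx
      by_cases hxI : x ∈ Set.Icc 0 t
      · have hlt : (∑ i, f i j (c i x)) + g j x < 0 := by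
          by_contra hcon
          exact hx ⟨hxI, not_lt.1 hcon⟩
        have := husc x hxI 0 hlt
        rw [eventually_nhdsWithin_iff] at this
        filter_upwards [this] with y hy hyZ
        exact absurd (hy hyZ.1) (not_lt.2 hyZ.2)
      · filter_upwards [isClosed_Icc.isOpen_compl.mem_nhds hxI] with y hy hyZ
        exact hy hyZ.1
    have hZne : Z.Nonempty := ⟨0, ⟨le_rfl, ht.1⟩, by simpa [hc0] using h0 j⟩
    have hZb : BddAbove Z := ⟨t, fun r hr => hr.1.2⟩
    have hsZ := hZc.csSup_mem hZne hZb
    set s := sSup Z with hs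
    have hgap : ∀ r ∈ Set.Ioc s t, (∑ i, f i j (c i r)) + g j r < 0 := by
      intro r hr
      by_contra hcon
      have : r ∈ Z := ⟨⟨hsZ.1.1.trans hr.1.le, hr.2⟩, not_lt.1 hcon⟩
      exact absurd (le_csSup hZb this) (not_le.2 hr.1)
    have heq : c j t = c j s := by
      have h1 := ((hpf j).2 s t hsZ.1.1 hsZ.1.2 ht.2).2
      have h2 : ∫ r in s..t, max ((∑ i, f i j (c i r)) + g j r) 0 = ∫ r in s..t, (0:ℝ) := by
        refine intervalIntegral.integral_congr_ae (Eventually.of_forall fun r hr => ?_)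
        rw [Set.uIoc_of_le hsZ.1.2] at hr
        exact max_eq_right (hgap r hr).le
      rw [h2] at h1
      simp at h1
      linarith
    have hle : (∑ i, f i j (c i s)) + g j s ≤ (∑ i, f i j (c i t)) + g j t := by
      refine add_le_add (Finset.sum_le_sum fun i _ => ?_) (hmg j hsZ.1.2)
      by_cases hij : i = j
      · subst hij
        rw [heq]
      · exact hmf i j hij (hmono i s t hsZ.1.1 hsZ.1.2 ht.2)
    have := hsZ.2
    linarith
  refine ⟨c, ?_, hnn, hmax⟩
  intro j
  have hcong : ∀ t ∈ Set.Icc 0 T, Set.EqOn (fun s => max ((∑ i, f i j (c i s)) + g j s) 0)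
      (fun s => (∑ i, f i j (c i s)) + g j s) (Set.uIcc 0 t) := by
    intro t ht r hr
    rw [Set.uIcc_of_le ht.1] at hr
    exact max_eq_left (hnn j r ⟨hr.1, hr.2.trans ht.2⟩)
  refine ⟨(hc j).1.congr ((hcong T ⟨hT, le_rfl⟩).mono Set.uIoc_subset_uIcc), fun t ht => ?_⟩
  rw [(hc j).2 t ht]
  exact intervalIntegral.integral_congr (hcong t ht)

lemma ev_split {p : ℝ → Prop} {x : ℝ} (h1 : ∀ᶠ y in 𝓝[<] x, p y) (h2 : p x)
    (h3 : ∀ᶠ y in 𝓝[>] x, p y) : ∀ᶠ y in 𝓝 x, p y := by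
  rw [eventually_nhdsWithin_iff] at h1 h3
  filter_upwards [h1, h3] with y hy1 hy3
  rcases lt_trichotomy y x with h | h | h
  · exact hy1 h
  · exact h ▸ h2
  · exact hy3 h

lemma Cadlag.rc {φ : ℝ → ℝ} (h : Cadlag φ) {x : ℝ} (hx : 0 ≤ x) :
    ContinuousWithinAt φ (Set.Ici x) x :=
  continuousWithinAt_Ioi_iff_Ici.1 (h.1 x hx ENNReal.ofReal_lt_top)

lemma Cadlag.leftLim_le {φ : ℝ → ℝ} (h : Cadlag φ) (hm : MonotoneOn φ (Set.Ici 0))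
    (t : ℝ) (ht : 0 < t) : Function.leftLim φ t ≤ φ t := by
  obtain ⟨l, hl⟩ := h.2 t ht ENNReal.ofReal_lt_top
  rw [leftLim_eq_of_tendsto hl]
  refine le_of_tendsto hl ?_
  filter_upwards [Ioo_mem_nhdsLT ht] with y hy
  exact hm hy.1.le ht.le hy.2.le

lemma Cadlag.usc {φ : ℝ → ℝ} (h : Cadlag φ)
    (hj : ∀ t : ℝ, 0 < t → Function.leftLim φ t ≤ φ t) :
    UpperSemicontinuousOn φ (Set.Ici 0) := by
  intro x hx y hy
  rw [eventually_nhdsWithin_iff]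
  refine ev_split ?_ (fun _ => hy) ?_
  · rcases (show (0:ℝ) ≤ x from hx).eq_or_lt with h0 | h0
    · filter_upwards [self_mem_nhdsWithin] with z hz hz0
      have h1 : z < x := hz
      have h2 : 0 ≤ z := hz0
      linarith
    · obtain ⟨l, hl⟩ := h.2 x h0 ENNReal.ofReal_lt_top
      have h1 := hj x h0
      rw [leftLim_eq_of_tendsto hl] at h1
      filter_upwards [hl.eventually (gt_mem_nhds (h1.trans_lt hy))] with z hz _ using hz
  · filter_upwards [(h.1 x hx ENNReal.ofReal_lt_top).eventually (gt_mem_nhds hy)] with z hz _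
      using hz

lemma Cadlag.reg {φ : ℝ → ℝ} (h : Cadlag φ)
    (hj : ∀ t : ℝ, 0 < t → Function.leftLim φ t ≤ φ t) {R : ℝ} (hR : 0 ≤ R) :
    Reg (fun x => φ (max 0 (min x R))) := by
  have hc : Continuous fun x : ℝ => max 0 (min x R) := by fun_prop
  have hu := h.usc hj
  constructor
  · obtain ⟨K, hK⟩ := (hu.mono (fun x hx => hx.1 : Set.Icc 0 R ⊆ Set.Ici 0)).bddAbove_of_isCompact
      isCompact_Icc
    refine ⟨K, fun x => hK ⟨_, ⟨le_max_left _ _, max_le hR (min_le_right _ _)⟩, rfl⟩⟩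
  · rw [← upperSemicontinuousOn_univ_iff]
    exact hu.comp hc.continuousOn fun x _ => le_max_left 0 (min x R)
  · intro x
    refine ContinuousWithinAt.comp (t := Set.Ici (max 0 (min x R))) (h.rc (le_max_left _ _))
      hc.continuousWithinAt ?_
    intro y hy
    exact max_le_max le_rfl (min_le_min (Set.mem_Ici.1 hy) le_rfl)

lemma measurable_of_rc {φ : ℝ → ℝ} (h : ∀ x, ContinuousWithinAt φ (Set.Ici x) x) :
    Measurable φ := by
  refine measurable_of_tendsto_metrizable
    (f := fun (n : ℕ) x => φ (((⌊((n:ℝ)+1) * x⌋ : ℝ) + 1) / ((n:ℝ)+1))) ?_ ?_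
  · intro n
    have h1 : Measurable (fun k : ℤ => φ (((k:ℝ)+1) / ((n:ℝ)+1))) := measurable_from_top
    exact h1.comp (Int.measurable_floor.comp (measurable_const.mul measurable_id))
  · rw [tendsto_pi_nhds]
    intro x
    have hlow : ∀ n : ℕ, x ≤ ((⌊((n:ℝ)+1) * x⌋ : ℝ) + 1) / ((n:ℝ)+1) := by
      intro n
      rw [le_div_iff₀ (by positivity)]
      have := Int.lt_floor_add_one (((n:ℝ)+1) * x)
      linarith
    have hup : ∀ n : ℕ, ((⌊((n:ℝ)+1) * x⌋ : ℝ) + 1) / ((n:ℝ)+1) ≤ x + 1 / ((n:ℝ)+1) := by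
      intro n
      have hp : (0:ℝ) < (n:ℝ)+1 := by positivity
      rw [div_le_iff₀ hp, add_mul x, one_div, inv_mul_cancel₀ hp.ne']
      have := Int.floor_le (((n:ℝ)+1) * x)
      linarith
    have hlim : Tendsto (fun n : ℕ => ((⌊((n:ℝ)+1) * x⌋ : ℝ) + 1) / ((n:ℝ)+1)) atTop (𝓝 x) := by
      refine tendsto_of_tendsto_of_tendsto_of_le_of_le tendsto_const_nhds ?_ hlow hup
      have := (tendsto_const_nhds (x := x)).add
        (tendsto_one_div_add_atTop_nhds_zero_nat (𝕜 := ℝ))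
      simpa using this
    exact (h x).tendsto.comp (tendsto_nhdsWithin_iff.2 ⟨hlim, Eventually.of_forall hlow⟩)

lemma CadlagOn.intervalIntegrable {φ : ℝ → ℝ} {τ : ℝ≥0∞} (h : CadlagOn φ τ) {t : ℝ}
    (ht : 0 ≤ t) (htτ : ENNReal.ofReal t < τ) : IntervalIntegrable φ volume 0 t := by
  have hlt : ∀ x ∈ Set.Icc 0 t, ENNReal.ofReal x < τ := fun x hx =>
    (ENNReal.ofReal_le_ofReal hx.2).trans_lt htτ
  have hb : ∃ M, ∀ x ∈ Set.Icc 0 t, |φ x| ≤ M := by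
    refine isCompact_Icc.induction_on (p := fun s => ∃ M, ∀ x ∈ s, |φ x| ≤ M) ⟨0, by simp⟩ ?_ ?_ ?_
    · rintro s s' hss ⟨M, hM⟩
      exact ⟨M, fun x hx => hM x (hss hx)⟩
    · rintro s s' ⟨M, hM⟩ ⟨M', hM'⟩
      refine ⟨max M M', fun x hx => ?_⟩
      rcases hx with hx | hx
      · exact (hM x hx).trans (le_max_left _ _)
      · exact (hM' x hx).trans (le_max_right _ _)
    · intro x hx
      have h1 := (h.1 x hx.1 (hlt x hx)).abs.eventually (gt_mem_nhds (lt_add_one _))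
      have h2 : ∃ M, ∀ᶠ y in 𝓝[<] x, y ∈ Set.Icc 0 t → |φ y| ≤ M := by
        rcases hx.1.eq_or_lt with h0 | h0
        · refine ⟨0, ?_⟩
          filter_upwards [self_mem_nhdsWithin] with z hz hz0
          have h1 : z < x := hz
          have h2 : 0 ≤ z := hz0.1
          linarith
        · obtain ⟨l, hl⟩ := h.2 x h0 (hlt x hx)
          refine ⟨|l| + 1, ?_⟩
          filter_upwards [hl.abs.eventually (gt_mem_nhds (lt_add_one _))] with z hz _ using hz.le
      obtain ⟨M, hM⟩ := h2
      have h3 : ∀ᶠ y in 𝓝 x, y ∈ Set.Icc 0 t → |φ y| ≤ max M (|φ x| + 1) := by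
        refine ev_split ?_ ?_ ?_
        · filter_upwards [hM] with z hz hz0 using (hz hz0).trans (le_max_left _ _)
        · intro _
          exact le_trans (by linarith) (le_max_right _ _)
        · filter_upwards [h1] with z hz _ using hz.le.trans (le_max_right _ _)
      exact ⟨_, eventually_nhdsWithin_iff.2 h3, max M (|φ x| + 1), fun y hy => hy⟩
  obtain ⟨M, hM⟩ := hb
  have hmeas : Measurable (fun x => φ (max 0 (min x t))) := by
    refine measurable_of_rc fun x => ?_
    have hx : max 0 (min x t) ∈ Set.Icc 0 t := ⟨le_max_left _ _, max_le ht (min_le_right _ _)⟩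
    have hc : Continuous fun x : ℝ => max 0 (min x t) := by fun_prop
    refine ContinuousWithinAt.comp (t := Set.Ici (max 0 (min x t)))
      (continuousWithinAt_Ioi_iff_Ici.1 (h.1 _ hx.1 (hlt _ hx)))
      hc.continuousWithinAt ?_
    intro y hy
    exact max_le_max le_rfl (min_le_min (Set.mem_Ici.1 hy) le_rfl)
  have hI : IntervalIntegrable (fun x => φ (max 0 (min x t))) volume 0 t := by
    refine IntervalIntegrable.mono_fun' (g := fun _ => M) intervalIntegrable_const
      hmeas.aestronglyMeasurable ?_
    refine Eventually.of_forall fun x => ?_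
    exact hM _ ⟨le_max_left _ _, max_le ht (min_le_right _ _)⟩
  refine hI.congr fun x hx => ?_
  rw [Set.uIoc_of_le ht] at hx
  simp only [min_eq_left hx.2, max_eq_right hx.1.le]

lemma Cadlag.comp_right {φ c : ℝ → ℝ} (h : Cadlag φ) {t : ℝ} (h0 : 0 ≤ c t)
    (hc : Tendsto c (𝓝[>] t) (𝓝 (c t))) (hm : ∀ᶠ s in 𝓝[>] t, c t ≤ c s) :
    Tendsto (fun s => φ (c s)) (𝓝[>] t) (𝓝 (φ (c t))) :=
  (h.rc h0).tendsto.comp (tendsto_nhdsWithin_iff.2 ⟨hc, hm⟩)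

lemma Cadlag.comp_left {φ c : ℝ → ℝ} (h : Cadlag φ) {t : ℝ} (ht : 0 < t) (h0 : 0 ≤ c 0)
    (hc : ContinuousOn c (Set.Icc 0 t)) (hm : MonotoneOn c (Set.Icc 0 t)) :
    ∃ l, Tendsto (fun s => φ (c s)) (𝓝[<] t) (𝓝 l) := by
  have htm : t ∈ Set.Icc 0 t := ⟨ht.le, le_rfl⟩
  by_cases hs : ∃ s ∈ Set.Ico 0 t, c s = c t
  · obtain ⟨s, hs, hst⟩ := hs
    refine ⟨φ (c t), tendsto_const_nhds.congr' ?_⟩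
    filter_upwards [Ioo_mem_nhdsLT hs.2] with y hy
    have hyI : y ∈ Set.Icc 0 t := ⟨hs.1.trans hy.1.le, hy.2.le⟩
    have h1 := hm ⟨hs.1, hs.2.le⟩ hyI hy.1.le
    have h2 := hm hyI htm hy.2.le
    rw [le_antisymm h2 (hst ▸ h1)]
  · push Not at hs
    have hlt : ∀ s ∈ Set.Ico 0 t, c s < c t := fun s hs' =>
      lt_of_le_of_ne (hm ⟨hs'.1, hs'.2.le⟩ htm hs'.2.le) (hs s hs')
    obtain ⟨l, hl⟩ := h.2 (c t) (h0.trans_lt (hlt 0 ⟨le_rfl, ht⟩)) ENNReal.ofReal_lt_top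
    refine ⟨l, hl.comp (tendsto_nhdsWithin_iff.2 ⟨?_, ?_⟩)⟩
    · refine (hc t htm).tendsto.mono_left ?_
      rw [← nhdsWithin_Ico_eq_nhdsLT ht]
      exact nhdsWithin_mono _ Set.Ico_subset_Icc_self
    · filter_upwards [Ioo_mem_nhdsLT ht] with y hy using hlt y ⟨hy.1.le, hy.2⟩

lemma Sol.congr {m : ℕ} {f f' : Fin m → Fin m → ℝ → ℝ} {g g' : Fin m → ℝ → ℝ} {S : ℝ}
    (hS : 0 ≤ S) {u : Fin m → ℝ → ℝ} (h : Sol f g S u)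
    (hf : ∀ i j, ∀ s ∈ Set.Icc 0 S, f i j (u i s) = f' i j (u i s))
    (hg : ∀ j, ∀ s ∈ Set.Icc 0 S, g j s = g' j s) : Sol f' g' S u := by
  intro j
  have key : ∀ s ∈ Set.Icc 0 S, (∑ i, f i j (u i s)) + g j s = (∑ i, f' i j (u i s)) + g' j s := by
    intro s hs
    rw [hg j s hs, Finset.sum_congr rfl fun i _ => hf i j s hs]
  refine ⟨(h j).1.congr fun s hs => ?_, fun t ht => ?_⟩
  · rw [Set.uIoc_of_le hS] at hs
    exact key s ⟨hs.1.le, hs.2⟩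
  · rw [(h j).2 t ht]
    refine intervalIntegral.integral_congr fun s hs => ?_
    rw [Set.uIcc_of_le ht.1] at hs
    exact key s ⟨hs.1, hs.2.trans ht.2⟩

lemma Sol.mono {m : ℕ} {f : Fin m → Fin m → ℝ → ℝ} {g : Fin m → ℝ → ℝ} {S S' : ℝ}
    (hS : 0 ≤ S) (hSS : S ≤ S') {u : Fin m → ℝ → ℝ} (h : Sol f g S' u) : Sol f g S u := by
  intro j
  refine ⟨(h j).1.mono_set ?_, fun t ht => (h j).2 t ⟨ht.1, ht.2.trans hSS⟩⟩
  rw [Set.uIcc_of_le hS, Set.uIcc_of_le (hS.trans hSS)]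
  exact Set.Icc_subset_Icc_right hSS

/-- general existence of a maximal, possibly exploding, solution. -/
theorem stmt2 (m : ℕ) (hm : 1 ≤ m)
    (f : Fin m → Fin m → ℝ → ℝ) (g : Fin m → ℝ → ℝ)
    (hH : HypH m f g) :
    ∃ τ : ℝ≥0∞, 0 < τ ∧ ∃ h : Fin m → ℝ → ℝ,
      IsSolutionOn m f g τ h ∧ NonnegOn m τ h ∧
      (τ < ⊤ → ExplodesAt m τ h) ∧
      (∀ τ' : ℝ≥0∞, ∀ h' : Fin m → ℝ → ℝ, 0 < τ' →
        IsSolutionOn m f g τ' h' → NonnegOn m τ' h' →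
        ∀ j, ∀ t : ℝ, 0 ≤ t → ENNReal.ofReal t < τ → ENNReal.ofReal t < τ' →
          prim (h' j) t ≤ prim (h j) t) := by
  have hlf : ∀ i j, ∀ t : ℝ, 0 < t → Function.leftLim (f i j) t ≤ f i j t := by
    intro i j
    by_cases hij : i = j
    · subst hij
      exact hH.no_neg_jumps i
    · exact (hH.cadlag_f i j).leftLim_le (hH.mono_f i j hij)
  have hlg : ∀ j, ∀ t : ℝ, 0 < t → Function.leftLim (g j) t ≤ g j t := fun j =>
    (hH.cadlag_g j).leftLim_le (hH.mono_g j)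
  let fR : ℝ → Fin m → Fin m → ℝ → ℝ := fun R i j x => f i j (max 0 (min x R))
  let gR : ℝ → Fin m → ℝ → ℝ := fun R j x => g j (max 0 (min x R))
  have hclm : ∀ R : ℝ, Monotone fun x : ℝ => max 0 (min x R) := fun R x y hxy =>
    max_le_max le_rfl (min_le_min hxy le_rfl)
  have hex : ∀ R : ℝ, ∃ c : Fin m → ℝ → ℝ, 0 < R → (Sol (fR R) (gR R) R c ∧
      (∀ j, ∀ t ∈ Set.Icc 0 R, 0 ≤ (∑ i, fR R i j (c i t)) + gR R j t) ∧
      ∀ S ∈ Set.Icc 0 R, ∀ u, Sol (fR R) (gR R) S u → ∀ j, ∀ t ∈ Set.Icc 0 S, u j t ≤ c j t) := by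
    intro R
    by_cases hR : 0 < R
    · obtain ⟨c, hc⟩ := core hR.le (fR R) (gR R)
        (fun i j => (hH.cadlag_f i j).reg (hlf i j) hR.le)
        (fun j => (hH.cadlag_g j).reg (hlg j) hR.le)
        (fun i j hij x y hxy => hH.mono_f i j hij (le_max_left 0 (min x R)) (le_max_left 0 (min y R))
          (hclm R hxy))
        (fun j x y hxy => hH.mono_g j (le_max_left 0 (min x R)) (le_max_left 0 (min y R))
          (hclm R hxy))
        (fun j => by
          have := hH.init_nonneg j
          simp only [fR, gR, min_eq_left hR.le, max_self]
          linarith)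
      exact ⟨c, fun _ => hc⟩
    · exact ⟨fun _ _ => 0, fun h => absurd h hR⟩
  choose C hC using hex
  have hpf := fun (R : ℝ) (hR : 0 < R) j =>
    prim_facts hR.le ((hC R hR).1 j).1 ((hC R hR).1 j).2
  have hcont : ∀ R, 0 < R → ∀ j, ContinuousOn (C R j) (Set.Icc 0 R) := fun R hR j =>
    (hpf R hR j).1
  have hmono : ∀ R, 0 < R → ∀ j, MonotoneOn (C R j) (Set.Icc 0 R) := by
    intro R hR j s hs t ht hst
    have h1 := ((hpf R hR j).2 s t hs.1 hst ht.2).2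
    have h2 : 0 ≤ ∫ r in s..t, ((∑ i, fR R i j (C R i r)) + gR R j r) :=
      intervalIntegral.integral_nonneg hst fun r hr =>
        (hC R hR).2.1 j r ⟨hs.1.trans hr.1, hr.2.trans ht.2⟩
    linarith
  have hC0 : ∀ R, 0 < R → ∀ j, C R j 0 = 0 := fun R hR j => by
    rw [((hC R hR).1 j).2 0 ⟨le_rfl, hR.le⟩, intervalIntegral.integral_same]
  have hCnn : ∀ R, 0 < R → ∀ j, ∀ t ∈ Set.Icc 0 R, 0 ≤ C R j t := fun R hR j t ht => by
    rw [← hC0 R hR j]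
    exact hmono R hR j ⟨le_rfl, hR.le⟩ ht ht.1
  have hcl : ∀ R x : ℝ, 0 ≤ x → x ≤ R → max 0 (min x R) = x := fun R x h1 h2 => by
    rw [min_eq_left h2, max_eq_right h1]
  -- transfer between the truncated and the original system
  have toR : ∀ (R S : ℝ) (u : Fin m → ℝ → ℝ), 0 ≤ S → S ≤ R →
      (∀ i, ∀ s ∈ Set.Icc 0 S, 0 ≤ u i s ∧ u i s ≤ R) → Sol f g S u → Sol (fR R) (gR R) S u := by
    intro R S u hS hSR hu h
    refine h.congr hS (fun i j s hs => ?_) (fun j s hs => ?_)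
    · simp only [fR, hcl R _ (hu i s hs).1 (hu i s hs).2]
    · simp only [gR, hcl R s hs.1 (hs.2.trans hSR)]
  have ofR : ∀ (R S : ℝ) (u : Fin m → ℝ → ℝ), 0 ≤ S → S ≤ R →
      (∀ i, ∀ s ∈ Set.Icc 0 S, 0 ≤ u i s ∧ u i s ≤ R) → Sol (fR R) (gR R) S u → Sol f g S u := by
    intro R S u hS hSR hu h
    refine h.congr hS (fun i j s hs => ?_) (fun j s hs => ?_)
    · simp only [fR, hcl R _ (hu i s hs).1 (hu i s hs).2]
    · simp only [gR, hcl R s hs.1 (hs.2.trans hSR)]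
  let Good : ℝ → ℝ → Prop := fun R t => 0 ≤ t ∧ t < R ∧ ∀ j, C R j t < R
  have Gpos : ∀ {R t}, Good R t → 0 < R := fun h => h.1.trans_lt h.2.1
  have Gdown : ∀ {R t s}, Good R t → 0 ≤ s → s ≤ t → Good R s := by
    intro R t s h hs hst
    refine ⟨hs, hst.trans_lt h.2.1, fun j => ?_⟩
    exact (hmono R (Gpos h) j ⟨hs, (hst.trans_lt h.2.1).le⟩ ⟨h.1, h.2.1.le⟩ hst).trans_lt (h.2.2 j)
  have Gsol : ∀ {R t}, Good R t → Sol f g t (C R) := by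
    intro R t h
    refine ofR R t _ h.1 h.2.1.le (fun i s hs => ⟨?_, ?_⟩) ((hC R (Gpos h)).1.mono h.1 h.2.1.le)
    · exact hCnn R (Gpos h) i s ⟨hs.1, hs.2.trans h.2.1.le⟩
    · exact ((Gdown h hs.1 hs.2).2.2 i).le
  have hB : ∀ (R S : ℝ) (u : Fin m → ℝ → ℝ), 0 < R → 0 ≤ S → S ≤ R →
      (∀ i, ∀ s ∈ Set.Icc 0 S, 0 ≤ u i s ∧ u i s ≤ R) → Sol f g S u →
      ∀ j, ∀ t ∈ Set.Icc 0 S, u j t ≤ C R j t := by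
    intro R S u hR hS hSR hu h
    exact (hC R hR).2.2 S ⟨hS, hSR⟩ u (toR R S u hS hSR hu h)
  have hnear : ∀ R, 0 < R → ∀ x, 0 ≤ x → x < R → ∀ M : ℝ, (∀ j, C R j x < M) →
      ∀ᶠ y in 𝓝[>] x, ∀ j, C R j y < M := by
    intro R hR x hx0 hxR M hM
    refine eventually_all.2 fun j => ?_
    have hsub : 𝓝[>] x ≤ 𝓝[Set.Icc 0 R] x := by
      rw [← nhdsWithin_Ioc_eq_nhdsGT hxR]
      exact nhdsWithin_mono _ fun y hy => ⟨hx0.trans hy.1.le, hy.2⟩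
    exact hsub ((hcont R hR j x ⟨hx0, hxR.le⟩).eventually (gt_mem_nhds (hM j)))
  have hclosed : ∀ R, 0 < R → ∀ t, t ≤ R → ContinuousOn (fun r j => C R j r) (Set.Icc 0 t) :=
    fun R hR t ht => continuousOn_pi.2 fun j => (hcont R hR j).mono (Set.Icc_subset_Icc_right ht)
  have hcons : ∀ {R R' t}, Good R t → R ≤ R' → ∀ j, C R j t = C R' j t := by
    intro R R' t h hRR j
    have hR := Gpos h
    have hR' : 0 < R' := hR.trans_le hRR
    refine le_antisymm ?_ ?_
    · refine hB R' t (C R) hR' h.1 (h.2.1.le.trans hRR) (fun i s hs => ⟨?_, ?_⟩) (Gsol h) j t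
        ⟨h.1, le_rfl⟩
      · exact hCnn R hR i s ⟨hs.1, hs.2.trans h.2.1.le⟩
      · exact ((Gdown h hs.1 hs.2).2.2 i).le.trans hRR
    · have main : Set.Icc 0 t ⊆ {r | ∀ j, C R' j r ≤ C R j r} := by
        refine IsClosed.Icc_subset_of_forall_mem_nhdsWithin ?_ ?_ ?_
        · rw [Set.inter_comm]
          exact isClosed_Icc.isClosed_le (hclosed R' hR' t (h.2.1.le.trans hRR))
            (hclosed R hR t h.2.1.le)
        · intro j
          rw [hC0 R hR, hC0 R' hR']
        · rintro x ⟨hx, hx0, hxt⟩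
          have hGx := Gdown h hx0 hxt.le
          have h1 := hnear R' hR' x hx0 (hGx.2.1.trans_le hRR) R
            fun j => (hx j).trans_lt (hGx.2.2 j)
          filter_upwards [h1, Ioo_mem_nhdsGT hxt] with y hy hyt j
          have hy0 : 0 ≤ y := hx0.trans hyt.1.le
          have hyR : y < R := hyt.2.trans h.2.1
          have hGy : Good R' y := ⟨hy0, hyR.trans_le hRR, fun j => (hy j).trans_le hRR⟩
          refine hB R y (C R') hR hy0 hyR.le (fun i s hs => ⟨?_, ?_⟩) (Gsol hGy) j y
            ⟨hy0, le_rfl⟩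
          · exact hCnn R' hR' i s ⟨hs.1, hs.2.trans hGy.2.1.le⟩
          · exact (hmono R' hR' i ⟨hs.1, hs.2.trans hGy.2.1.le⟩ ⟨hy0, hGy.2.1.le⟩ hs.2).trans
              (hy i).le
      exact main ⟨h.1, le_rfl⟩ j
  have hRf : ∀ t : ℝ, ∃ R : ℝ, (∃ R', Good R' t) → Good R t := by
    intro t
    by_cases ht : ∃ R', Good R' t
    · exact ⟨ht.choose, fun _ => ht.choose_spec⟩
    · exact ⟨0, fun h => absurd h ht⟩
  choose Rf hRf using hRf
  let h : Fin m → ℝ → ℝ := fun j t => (∑ i, f i j (C (Rf t) i t)) + g j t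
  have hceq : ∀ {R t}, Good R t → ∀ j, C (Rf t) j t = C R j t := by
    intro R t hG j
    have hG' := hRf t ⟨R, hG⟩
    rcases le_total (Rf t) R with hle | hle
    · exact hcons hG' hle j
    · exact (hcons hG hle j).symm
  have hheq : ∀ {R t}, Good R t → ∀ j, h j t = (∑ i, f i j (C R i t)) + g j t := by
    intro R t hG j
    simp only [h]
    rw [Finset.sum_congr rfl fun i _ => by rw [hceq hG i]]
  have hprim : ∀ {R t}, Good R t → ∀ j, prim (h j) t = C R j t := by
    intro R t hG j
    rw [(Gsol hG j).2 t ⟨hG.1, le_rfl⟩]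
    refine intervalIntegral.integral_congr fun s hs => ?_
    rw [Set.uIcc_of_le hG.1] at hs
    exact hheq (Gdown hG hs.1 hs.2) j
  let τ : ℝ≥0∞ := ⨆ t ∈ {t : ℝ | ∃ R, Good R t}, ENNReal.ofReal t
  have hlt : ∀ t : ℝ, 0 ≤ t → ENNReal.ofReal t < τ → ∃ R t', t < t' ∧ Good R t' := by
    intro t ht h1
    simp only [τ, lt_iSup_iff] at h1
    obtain ⟨t', ⟨R, hG⟩, h2⟩ := h1
    exact ⟨R, t', (ENNReal.ofReal_lt_ofReal_iff_of_nonneg ht).1 h2, hG⟩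
  have hgood : ∀ t : ℝ, 0 ≤ t → ENNReal.ofReal t < τ → ∃ R, Good R t := by
    intro t ht h1
    obtain ⟨R, t', htt, hG⟩ := hlt t ht h1
    exact ⟨R, Gdown hG ht htt.le⟩
  have hopen : ∀ {R t}, Good R t → ENNReal.ofReal t < τ := by
    intro R t hG
    have h1 := hnear R (Gpos hG) t hG.1 hG.2.1 R hG.2.2
    obtain ⟨y, hy, hyt⟩ := (h1.and (Ioo_mem_nhdsGT hG.2.1)).exists
    have hGy : Good R y := ⟨hG.1.trans hyt.1.le, hyt.2, hy⟩
    have h2 : ENNReal.ofReal t < ENNReal.ofReal y :=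
      (ENNReal.ofReal_lt_ofReal_iff_of_nonneg hG.1).2 hyt.1
    exact h2.trans_le (le_iSup₂_of_le y ⟨R, hGy⟩ le_rfl)
  refine ⟨τ, ?_, h, ⟨?_, ?_⟩, ?_, ?_, ?_⟩
  · have hG : Good 1 0 := ⟨le_rfl, one_pos, fun j => by rw [hC0 1 one_pos]; exact one_pos⟩
    simpa using hopen hG
  · intro j
    constructor
    · intro t ht htτ
      obtain ⟨R, t', htt, hG⟩ := hlt t ht htτ
      have hR := Gpos hG
      have hGt := Gdown hG ht htt.le
      rw [hheq hGt j]
      have hsub : 𝓝[>] t ≤ 𝓝[Set.Icc 0 R] t := by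
        rw [← nhdsWithin_Ioc_eq_nhdsGT hGt.2.1]
        exact nhdsWithin_mono _ fun y hy => ⟨ht.trans hy.1.le, hy.2⟩
      have hev : (fun s => (∑ i, f i j (C R i s)) + g j s) =ᶠ[𝓝[>] t] h j := by
        filter_upwards [Ioo_mem_nhdsGT htt] with s hs
        exact (hheq (Gdown hG (ht.trans hs.1.le) hs.2.le) j).symm
      refine Tendsto.congr' hev ?_
      refine Tendsto.add (tendsto_finsetSum _ fun i _ => ?_)
        ((hH.cadlag_g j).1 t ht ENNReal.ofReal_lt_top)
      refine (hH.cadlag_f i j).comp_right (hCnn R hR i t ⟨ht, hGt.2.1.le⟩)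
        ((hcont R hR i t ⟨ht, hGt.2.1.le⟩).tendsto.mono_left hsub) ?_
      filter_upwards [Ioo_mem_nhdsGT hGt.2.1] with s hs
      exact hmono R hR i ⟨ht, hGt.2.1.le⟩ ⟨ht.trans hs.1.le, hs.2.le⟩ hs.1.le
    · intro t ht htτ
      obtain ⟨R, hG⟩ := hgood t ht.le htτ
      have hR := Gpos hG
      have hss : Set.Icc 0 t ⊆ Set.Icc 0 R := Set.Icc_subset_Icc_right hG.2.1.le
      choose l hl using fun i => (hH.cadlag_f i j).comp_left ht (hC0 R hR i).ge
        ((hcont R hR i).mono hss) ((hmono R hR i).mono hss)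
      obtain ⟨lg, hlg⟩ := (hH.cadlag_g j).2 t ht ENNReal.ofReal_lt_top
      have hev : (fun s => (∑ i, f i j (C R i s)) + g j s) =ᶠ[𝓝[<] t] h j := by
        filter_upwards [Ioo_mem_nhdsLT ht] with s hs
        exact (hheq (Gdown hG hs.1.le hs.2.le) j).symm
      exact ⟨(∑ i, l i) + lg,
        Tendsto.congr' hev (Tendsto.add (tendsto_finsetSum _ fun i _ => hl i) hlg)⟩
  · intro j t ht htτ
    obtain ⟨R, hG⟩ := hgood t ht htτ
    rw [hheq hG j, Finset.sum_congr rfl fun i _ => by rw [← hprim hG i]]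
  · intro j t ht htτ
    obtain ⟨R, hG⟩ := hgood t ht htτ
    have h1 := (hC R (Gpos hG)).2.1 j t ⟨ht, hG.2.1.le⟩
    rw [hheq hG j]
    have h2 : (∑ i, f i j (C R i t)) = ∑ i, fR R i j (C R i t) :=
      Finset.sum_congr rfl fun i _ => by
        simp only [fR, hcl R _ (hCnn R (Gpos hG) i t ⟨ht, hG.2.1.le⟩) (hG.2.2 i).le]
    have h3 : g j t = gR R j t := by simp only [gR, hcl R t ht hG.2.1.le]
    rw [h2, h3]
    exact h1
  · intro hτ
    by_contra hne
    simp only [ExplodesAt] at hne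
    push Not at hne
    choose M hM using hne
    set T := τ.toReal with hT
    have hT0 : 0 ≤ T := ENNReal.toReal_nonneg
    have hTτ : ENNReal.ofReal T = τ := ENNReal.ofReal_toReal hτ.ne
    set Q := ∑ j, |M j| with hQ
    have hQ0 : 0 ≤ Q := Finset.sum_nonneg fun j _ => abs_nonneg _
    have hMQ : ∀ j, M j ≤ Q := fun j => (le_abs_self _).trans
      (Finset.single_le_sum (f := fun j => |M j|) (fun j _ => abs_nonneg _) (Finset.mem_univ j))
    have hR : 0 < T + Q + 1 := by positivity
    have hTR : T < T + Q + 1 := by linarith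
    have main : Set.Icc 0 T ⊆ {r | ∀ j, C (T + Q + 1) j r ≤ Q} := by
      refine IsClosed.Icc_subset_of_forall_mem_nhdsWithin ?_ ?_ ?_
      · rw [Set.inter_comm]
        exact isClosed_Icc.isClosed_le (hclosed _ hR T hTR.le)
          (continuousOn_const (c := fun _ => Q))
      · intro j
        rw [hC0 _ hR]
        exact hQ0
      · rintro x ⟨hx, hx0, hxT⟩
        have h1 := hnear (T + Q + 1) hR x hx0 (hxT.trans hTR) (T + Q + 1)
          fun j => (hx j).trans_lt (by linarith)
        filter_upwards [h1, Ioo_mem_nhdsGT hxT] with y hy hyT j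
        have hGy : Good (T + Q + 1) y := ⟨hx0.trans hyT.1.le, hyT.2.trans hTR, hy⟩
        rw [← hprim hGy j]
        exact (hM j y hGy.1 (hopen hGy)).le.trans (hMQ j)
    have hGT : Good (T + Q + 1) T := ⟨hT0, hTR, fun j =>
      (main ⟨hT0, le_rfl⟩ j).trans_lt (by linarith)⟩
    have := hopen hGT
    rw [hTτ] at this
    exact lt_irrefl _ this
  · intro τ' h' _ hsol hnn j t ht htτ htτ'
    obtain ⟨R, hG⟩ := hgood t ht htτ
    rw [hprim hG j]
    have hlt' : ∀ s ∈ Set.Icc 0 t, ENNReal.ofReal s < τ' := fun s hs =>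
      (ENNReal.ofReal_le_ofReal hs.2).trans_lt htτ'
    have hI : ∀ j, IntervalIntegrable (h' j) volume 0 t := fun j =>
      (hsol.1 j).intervalIntegrable ht htτ'
    have hpf' := fun j => prim_facts ht (hI j) (c := prim (h' j)) (fun t _ => rfl)
    have hmono' : ∀ j, ∀ s ∈ Set.Icc 0 t, ∀ r ∈ Set.Icc 0 t, s ≤ r →
        prim (h' j) s ≤ prim (h' j) r := by
      intro j s hs r hr hsr
      have h1 := ((hpf' j).2 s r hs.1 hsr hr.2).2
      have h2 : 0 ≤ ∫ q in s..r, h' j q := intervalIntegral.integral_nonneg hsr fun q hq =>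
        hnn j q (hs.1.trans hq.1) (hlt' q ⟨hs.1.trans hq.1, hq.2.trans hr.2⟩)
      linarith
    have h00 : ∀ j, prim (h' j) 0 = 0 := fun j => intervalIntegral.integral_same
    have hS : Sol f g t (fun j => prim (h' j)) := by
      intro j
      refine ⟨(hI j).congr fun s hs => ?_, fun r hr => ?_⟩
      · rw [Set.uIoc_of_le ht] at hs
        exact hsol.2 j s hs.1.le (hlt' s ⟨hs.1.le, hs.2⟩)
      · refine intervalIntegral.integral_congr fun s hs => ?_
        rw [Set.uIcc_of_le hr.1] at hs
        exact hsol.2 j s hs.1 (hlt' s ⟨hs.1, hs.2.trans hr.2⟩)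
    set Q := ∑ j, |prim (h' j) t| with hQ
    have hQ0 : 0 ≤ Q := Finset.sum_nonneg fun j _ => abs_nonneg _
    have hMQ : ∀ j, prim (h' j) t ≤ Q := fun j => (le_abs_self _).trans
      (Finset.single_le_sum (f := fun j => |prim (h' j) t|) (fun j _ => abs_nonneg _)
        (Finset.mem_univ j))
    have hR := Gpos hG
    rw [hcons hG (R' := R + Q) (by linarith) j]
    refine hB (R + Q) t (fun j => prim (h' j)) (by linarith) ht (by linarith [hG.2.1])
      (fun i s hs => ⟨?_, ?_⟩) hS j t ⟨ht, le_rfl⟩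
    · rw [← h00 i]
      exact hmono' i 0 ⟨le_rfl, ht⟩ s hs hs.1
    · have := hmono' i s hs t ⟨ht, le_rfl⟩ hs.2
      have := hMQ i
      linarith
end
end

section
/- Let P = (f^{i,j}, g^j) and P̃ = (f̃^{i,j}, g̃^j) (1 ≤ i,j ≤ m) both satisfy hypotheses (H), with f^{i,j}(x) ≤ f̃^{i,j}(x) and g^j(t) ≤ g̃^j(t) for all i, j, x, t. If h and h̃ are non-negative solutions on [0,∞) of the time-change system driven by P and by P̃ respectively, with primitives c and c̃, and h has no spontaneous generation, then c^j(t) ≤ c̃^j(t) for all j and t ≥ 0. Consequently, for a fixed family P satisfying (H), the time-change system admits at most one non-negative solution on [0,∞) having no spontaneous generation. -/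
open MeasureTheory Filter Function Set
open scoped ENNReal Topology

noncomputable section

/-- Extension of a càdlàg function by a constant on the negative half-line. -/
lemma aux_ext_right {h : ℝ → ℝ} (hc : CadlagOn h ⊤) (t : ℝ) :
    Tendsto (fun s => h (max s 0)) (𝓝[>] t) (𝓝 (h (max t 0))) := by
  rcases lt_or_ge t 0 with ht | ht
  · have : (fun s => h (max s 0)) =ᶠ[𝓝[>] t] fun _ => h (max t 0) := by
      filter_upwards [mem_nhdsWithin_of_mem_nhds (Iio_mem_nhds ht)] with s hs
      have hs' : s < 0 := hs
      rw [max_eq_right hs'.le, max_eq_right ht.le]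
    exact tendsto_const_nhds.congr' this.symm
  · have h1 := hc.1 t ht ENNReal.ofReal_lt_top
    rw [max_eq_left ht]
    refine h1.congr' ?_
    filter_upwards [self_mem_nhdsWithin] with s hs
    have hs' : t < s := hs
    rw [max_eq_left (ht.trans hs'.le)]

lemma aux_ext_left {h : ℝ → ℝ} (hc : CadlagOn h ⊤) (t : ℝ) :
    ∃ l, Tendsto (fun s => h (max s 0)) (𝓝[<] t) (𝓝 l) := by
  rcases le_or_gt t 0 with ht | ht
  · refine ⟨h 0, ?_⟩
    have : (fun s => h (max s 0)) =ᶠ[𝓝[<] t] fun _ => h 0 := by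
      filter_upwards [self_mem_nhdsWithin] with s hs
      have hs' : s < t := hs
      rw [max_eq_right (hs'.le.trans ht)]
    exact tendsto_const_nhds.congr' this.symm
  · obtain ⟨l, hl⟩ := hc.2 t ht ENNReal.ofReal_lt_top
    refine ⟨l, hl.congr' ?_⟩
    filter_upwards [mem_nhdsWithin_of_mem_nhds (Ioi_mem_nhds ht)] with s hs
    have hs' : 0 < s := hs
    rw [max_eq_left hs'.le]

lemma aux_measurable {H : ℝ → ℝ} (hr : ∀ t, Tendsto H (𝓝[>] t) (𝓝 (H t))) : Measurable H := by
  have hm : ∀ n : ℕ, Measurable (fun t : ℝ => H (((⌊((n:ℝ)+1) * t⌋ : ℤ) + 1 : ℝ) / ((n:ℝ)+1))) := by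
    intro n
    have h1 : Measurable (fun k : ℤ => H (((k:ℝ) + 1) / ((n:ℝ)+1))) := measurable_from_top
    have h2 : Measurable (fun t : ℝ => ⌊((n:ℝ)+1) * t⌋) :=
      Int.measurable_floor.comp (measurable_const.mul measurable_id)
    exact h1.comp h2
  refine measurable_of_tendsto_metrizable hm ?_
  rw [tendsto_pi_nhds]
  intro t
  refine (hr t).comp ?_
  have hgt : ∀ n : ℕ, t < ((⌊((n:ℝ)+1) * t⌋ : ℤ) + 1 : ℝ) / ((n:ℝ)+1) := by
    intro n
    have hn : (0:ℝ) < (n:ℝ)+1 := by positivity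
    rw [lt_div_iff₀ hn]
    have := Int.lt_floor_add_one (((n:ℝ)+1) * t)
    linarith
  have hle : ∀ n : ℕ, ((⌊((n:ℝ)+1) * t⌋ : ℤ) + 1 : ℝ) / ((n:ℝ)+1) ≤ t + 1 / ((n:ℝ)+1) := by
    intro n
    have hn : (0:ℝ) < (n:ℝ)+1 := by positivity
    have := Int.floor_le (((n:ℝ)+1) * t)
    have h1 : (t + 1 / ((n:ℝ)+1)) * ((n:ℝ)+1) = ((n:ℝ)+1) * t + 1 := by
      field_simp
    rw [div_le_iff₀ hn, h1]
    linarith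
  refine tendsto_nhdsWithin_iff.2 ⟨?_, Eventually.of_forall hgt⟩
  refine tendsto_of_tendsto_of_tendsto_of_le_of_le tendsto_const_nhds ?_
    (fun n => (hgt n).le) hle
  simpa using (tendsto_const_nhds (x := t)).add (tendsto_one_div_add_atTop_nhds_zero_nat (𝕜 := ℝ))

lemma aux_locInt {H : ℝ → ℝ} (hr : ∀ t, Tendsto H (𝓝[>] t) (𝓝 (H t)))
    (hl : ∀ t, ∃ l, Tendsto H (𝓝[<] t) (𝓝 l)) : LocallyIntegrable H volume := by
  have hm := aux_measurable hr
  intro t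
  rw [← nhdsLT_sup_nhdsGE, IntegrableAtFilter.sup_iff]
  obtain ⟨l, hl⟩ := hl t
  have hmf : ∀ F : Filter ℝ, StronglyMeasurableAtFilter H F volume := fun F =>
    ⟨univ, univ_mem, hm.aestronglyMeasurable⟩
  refine ⟨hl.integrableAtFilter (hmf _) ?_, Tendsto.integrableAtFilter (b := H t) (hmf _) ?_ ?_⟩
  · exact (volume.finiteAt_nhds t).filter_mono nhdsWithin_le_nhds
  · exact (volume.finiteAt_nhds t).filter_mono nhdsWithin_le_nhds
  · exact (continuousWithinAt_Ioi_iff_Ici.1 (hr t))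

/-- A good global version of the primitive. -/
lemma aux_prim {h : ℝ → ℝ} (hc : CadlagOn h ⊤) (hnn : ∀ t, 0 ≤ t → 0 ≤ h t) :
    ∃ c : ℝ → ℝ, Continuous c ∧ Monotone c ∧ c 0 = 0 ∧ (∀ t, 0 ≤ t → prim h t = c t) ∧
      ∀ t, 0 ≤ t → HasDerivWithinAt c (h t) (Ici t) t := by
  set H : ℝ → ℝ := fun s => h (max s 0) with hH
  have hr : ∀ t, Tendsto H (𝓝[>] t) (𝓝 (H t)) := aux_ext_right hc
  have hm := aux_measurable hr
  have hLI := aux_locInt hr (aux_ext_left hc)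
  have hint : ∀ a b, IntervalIntegrable H volume a b := fun a b =>
    (hLI.integrableOn_isCompact isCompact_uIcc).intervalIntegrable
  refine ⟨fun t => ∫ s in (0:ℝ)..t, H s, intervalIntegral.continuous_primitive hint 0, ?_, ?_, ?_, ?_⟩
  · intro a b hab
    have h1 := intervalIntegral.integral_add_adjacent_intervals (hint 0 a) (hint a b)
    have h2 : 0 ≤ ∫ s in a..b, H s :=
      intervalIntegral.integral_nonneg hab (fun u _ => hnn _ (le_max_right _ _))
    show (∫ s in (0:ℝ)..a, H s) ≤ ∫ s in (0:ℝ)..b, H s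
    linarith
  · simp
  · intro t ht
    refine intervalIntegral.integral_congr ?_
    intro s hs
    rw [uIcc_of_le ht] at hs
    simp only [hH, max_eq_left hs.1]
  · intro t ht
    have : H t = h t := by simp only [hH, max_eq_left ht]
    rw [← this]
    exact intervalIntegral.integral_hasDerivWithinAt_right (hint 0 t)
      ⟨univ, univ_mem, hm.aestronglyMeasurable⟩ (t := Ioi t) (hr t)

section core

variable {m : ℕ} {f ftil : Fin m → Fin m → ℝ → ℝ} {g gtil : Fin m → ℝ → ℝ}
  {h htil c ctil : Fin m → ℝ → ℝ}

lemma aux_touch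
    (hmono_f : ∀ i j, i ≠ j → MonotoneOn (f i j) (Set.Ici 0))
    (hmono_g : ∀ j, MonotoneOn (g j) (Set.Ici 0))
    (hle_f : ∀ i j, ∀ x : ℝ, 0 ≤ x → f i j x ≤ ftil i j x)
    (hle_g : ∀ j, ∀ t : ℝ, 0 ≤ t → g j t ≤ gtil j t)
    (hc0 : ∀ i t, 0 ≤ t → 0 ≤ c i t) (hct0 : ∀ i t, 0 ≤ t → 0 ≤ ctil i t)
    (heq : ∀ j, ∀ t : ℝ, 0 ≤ t → h j t = (∑ i, f i j (c i t)) + g j t)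
    (heqt : ∀ j, ∀ t : ℝ, 0 ≤ t → htil j t = (∑ i, ftil i j (ctil i t)) + gtil j t)
    (hnn : ∀ j, ∀ t : ℝ, 0 ≤ t → 0 ≤ h j t)
    {p x : ℝ} (hp : 0 ≤ p) (hpx : p ≤ x) (hle : ∀ k, c k p ≤ ctil k x)
    (j : Fin m) (hj : c j p = ctil j x) :
    h j p ≤ htil j x ∧ (htil j x = 0 → g j p = g j x ∧
      ∀ i, f i j (c i p) = f i j (ctil i x)) := by
  have hx : 0 ≤ x := hp.trans hpx
  have h1 : ∀ i ∈ Finset.univ, f i j (c i p) ≤ f i j (ctil i x) := by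
    intro i _
    by_cases hij : i = j
    · subst hij; rw [hj]
    · exact hmono_f i j hij (hc0 i p hp) (hct0 i x hx) (hle i)
  have h2 : ∑ i, f i j (ctil i x) ≤ ∑ i, ftil i j (ctil i x) :=
    Finset.sum_le_sum fun i _ => hle_f i j _ (hct0 i x hx)
  have h3 := Finset.sum_le_sum h1
  have h4 : g j p ≤ g j x := hmono_g j hp hx hpx
  have h5 := hle_g j x hx
  have h6 := heq j p hp
  have h7 := heqt j x hx
  have h8 := hnn j p hp
  refine ⟨by linarith, fun h0 => ⟨by linarith, ?_⟩⟩
  have h9 : ∑ i, f i j (c i p) = ∑ i, f i j (ctil i x) := by linarith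
  intro i
  exact (Finset.sum_eq_sum_iff_of_le h1).1 h9 i (Finset.mem_univ i)

lemma aux_deriv {C D : ℝ → ℝ} {r a x u v : ℝ} (hr : 0 < r)
    (hC : HasDerivWithinAt C u (Ici (r * (x - a))) (r * (x - a)))
    (hD : HasDerivWithinAt D v (Ici x) x) (he : C (r * (x - a)) = D x) (huv : r * u < v) :
    ∀ᶠ y in 𝓝[>] x, C (r * (y - a)) < D y := by
  have hin : HasDerivWithinAt (fun y : ℝ => r * (y - a)) r (Ici x) x := by
    have := (((hasDerivAt_id x).sub_const a).const_mul r).hasDerivWithinAt (s := Ici x)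
    simpa using this
  have hmaps : MapsTo (fun y : ℝ => r * (y - a)) (Ici x) (Ici (r * (x - a))) := by
    intro y hy
    have hy' : x ≤ y := hy
    show r * (x - a) ≤ r * (y - a)
    gcongr
  have hcomp := HasDerivWithinAt.comp x hC hin hmaps
  have hsub := (hD.sub hcomp).Ioi_of_Ici
  have hs := (hasDerivWithinAt_iff_tendsto_slope' self_notMem_Ioi).1 hsub
  have hpos : 0 < v - u * r := by linarith
  filter_upwards [hs.eventually (Ioi_mem_nhds hpos), self_mem_nhdsWithin] with y hy hxy
  have hxy' : x < y := hxy
  have hy' : 0 < slope (D - C ∘ fun y : ℝ => r * (y - a)) x y := hy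
  rw [slope_def_field] at hy'
  have := (div_pos_iff_of_pos_right (sub_pos.2 hxy')).1 hy'
  simp only [Pi.sub_apply, Function.comp] at this
  linarith

lemma aux_core
    (hmono_f : ∀ i j, i ≠ j → MonotoneOn (f i j) (Set.Ici 0))
    (hmono_g : ∀ j, MonotoneOn (g j) (Set.Ici 0))
    (hle_f : ∀ i j, ∀ x : ℝ, 0 ≤ x → f i j x ≤ ftil i j x)
    (hle_g : ∀ j, ∀ t : ℝ, 0 ≤ t → g j t ≤ gtil j t)
    (hc0 : ∀ i t, 0 ≤ t → 0 ≤ c i t) (hct0 : ∀ i t, 0 ≤ t → 0 ≤ ctil i t)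
    (heq : ∀ j, ∀ t : ℝ, 0 ≤ t → h j t = (∑ i, f i j (c i t)) + g j t)
    (heqt : ∀ j, ∀ t : ℝ, 0 ≤ t → htil j t = (∑ i, ftil i j (ctil i t)) + gtil j t)
    (hnn : ∀ j, ∀ t : ℝ, 0 ≤ t → 0 ≤ h j t)
    (hnnt : ∀ j, ∀ t : ℝ, 0 ≤ t → 0 ≤ htil j t)
    (hcc : ∀ j, Continuous (c j)) (hctc : ∀ j, Continuous (ctil j))
    (hcm : ∀ j, Monotone (c j)) (hctm : ∀ j, Monotone (ctil j))
    (hd : ∀ j t, 0 ≤ t → HasDerivWithinAt (c j) (h j t) (Ici t) t)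
    (hdt : ∀ j t, 0 ≤ t → HasDerivWithinAt (ctil j) (htil j t) (Ici t) t)
    (hnsg : ∀ s : ℝ, 0 ≤ s → ∀ J : Finset (Fin m), (∀ j ∈ J, h j s = 0) →
      ∀ j ∈ J, (∀ t : ℝ, s < t → c j s < c j t) →
        (∀ t : ℝ, s < t → g j s < g j t) ∨
        ∃ i : Fin m, i ∉ J ∧ ∀ t : ℝ, s < t → f i j (c i s) < f i j (c i t))
    {r : ℝ} (hr0 : 0 < r) (hr1 : r < 1) :
    ∀ (J : Finset (Fin m)) (a t0 t1 : ℝ), 0 < a → a ≤ t0 →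
      (∀ j ∈ J, c j (r * (t0 - a)) ≤ ctil j t0) →
      (∀ i, i ∉ J → ∀ u ∈ Icc t0 t1, c i (r * (u - a)) < ctil i u) →
      ∀ u ∈ Icc t0 t1, ∀ j ∈ J, c j (r * (u - a)) ≤ ctil j u := by
  intro J
  induction J using Finset.strongInduction with
  | H J ih =>
  intro a t0 t1 ha hat hinit hout
  have hphic : ∀ b : ℝ, Continuous (fun u : ℝ => r * (u - b)) := fun b => by fun_prop
  have hphim : ∀ b : ℝ, Monotone (fun u : ℝ => r * (u - b)) := by
    intro b y z hyz
    show r * (y - b) ≤ r * (z - b)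
    gcongr
  have hphi : ∀ (b : ℝ) (x : ℝ), Tendsto (fun u : ℝ => r * (u - b)) (𝓝[>] x) (𝓝 (r * (x - b))) :=
    fun b x => ((hphic b).tendsto x).mono_left nhdsWithin_le_nhds
  suffices hsub : Icc t0 t1 ⊆ {u | ∀ j ∈ J, c j (r * (u - a)) ≤ ctil j u} from
    fun u hu => hsub hu
  have hclosed : IsClosed {u : ℝ | ∀ j ∈ J, c j (r * (u - a)) ≤ ctil j u} := by
    have : {u : ℝ | ∀ j ∈ J, c j (r * (u - a)) ≤ ctil j u}
        = ⋂ j ∈ J, {u : ℝ | c j (r * (u - a)) ≤ ctil j u} := by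
      ext u; simp
    rw [this]
    exact isClosed_biInter fun j _ => isClosed_le ((hcc j).comp (hphic a)) (hctc j)
  refine IsClosed.Icc_subset_of_forall_exists_gt (hclosed.inter isClosed_Icc) hinit ?_
  rintro x ⟨hxs, hx0, hx1⟩ y hxy
  have hxy' : x < y := hxy
  suffices hev : ∀ᶠ u in 𝓝[>] x, ∀ j ∈ J, c j (r * (u - a)) ≤ ctil j u by
    obtain ⟨u, hu1, hu2⟩ := (hev.and (Ioc_mem_nhdsGT hxy')).exists
    exact ⟨u, hu1, hu2⟩
  have hxa : a ≤ x := hat.trans hx0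
  have hx00 : 0 < x := ha.trans_le hxa
  set p := r * (x - a) with hp
  have hp0 : 0 ≤ p := mul_nonneg hr0.le (sub_nonneg.2 hxa)
  have hpx : p < x := by
    have : r * (x - a) ≤ 1 * (x - a) := by
      have := sub_nonneg.2 hxa
      gcongr
    linarith
  have hle : ∀ k, c k p ≤ ctil k x := by
    intro k
    by_cases hk : k ∈ J
    · exact hxs k hk
    · exact (hout k hk x ⟨hx0, hx1.le⟩).le
  have htouch := fun j hj => aux_touch hmono_f hmono_g hle_f hle_g hc0 hct0 heq heqt hnn hp0 hpx.le
    hle j hj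
  classical
  set J' : Finset (Fin m) := J.filter (fun j => c j p = ctil j x ∧ htil j x = 0) with hJ'
  have hJ'sub : J' ⊆ J := Finset.filter_subset _ _
  have hstrict : ∀ i, i ∉ J' → ∀ᶠ u in 𝓝[>] x, c i (r * (u - a)) < ctil i u := by
    intro i hi
    rcases (hle i).lt_or_eq with hlt | he
    · have h1 : Tendsto (fun u => c i (r * (u - a))) (𝓝[>] x) (𝓝 (c i p)) :=
        ((hcc i).tendsto _).comp (hphi a x)
      have h2 : Tendsto (ctil i) (𝓝[>] x) (𝓝 (ctil i x)) :=
        ((hctc i).tendsto x).mono_left nhdsWithin_le_nhds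
      exact h1.eventually_lt h2 hlt
    · have hiJ : i ∈ J := by
        by_contra hiJ
        exact absurd he (hout i hiJ x ⟨hx0, hx1.le⟩).ne
      have hne : htil i x ≠ 0 := by
        intro h0
        exact hi (Finset.mem_filter.2 ⟨hiJ, he, h0⟩)
      have hpos : 0 < htil i x := lt_of_le_of_ne (hnnt i x hx00.le) hne.symm
      have h1 := (htouch i he).1
      have h0 := hnn i p hp0
      refine aux_deriv hr0 (hd i p hp0) (hdt i x hx00.le) he ?_
      nlinarith
  by_cases hJJ : J' = J
  ·
    have hmem : ∀ j ∈ J, c j p = ctil j x ∧ htil j x = 0 := by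
      intro j hj
      rw [← hJJ] at hj
      exact (Finset.mem_filter.1 hj).2
    have hz : ∀ j ∈ J, h j p = 0 := by
      intro j hj
      obtain ⟨h1, h2⟩ := hmem j hj
      have := (htouch j h1).1
      exact le_antisymm (by linarith) (hnn j p hp0)
    rw [Filter.eventually_all_finset]
    intro j hj
    obtain ⟨hj1, hj2⟩ := hmem j hj
    obtain ⟨hg, hf⟩ := (htouch j hj1).2 hj2
    have hnot : ¬ (∀ t : ℝ, p < t → c j p < c j t) := by
      intro hinc
      rcases hnsg p hp0 J hz j hj hinc with hgi | ⟨i, hiJ, hfi⟩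
      · exact absurd hg (hgi x hpx).ne
      · have hlt := hout i hiJ x ⟨hx0, hx1.le⟩
        have h1 : ∀ᶠ t in 𝓝[>] p, c i t < ctil i x :=
          ((hcc i).tendsto p).mono_left nhdsWithin_le_nhds |>.eventually (Iio_mem_nhds hlt)
        obtain ⟨t, ht1, ht2⟩ := (h1.and self_mem_nhdsWithin).exists
        have ht2' : p < t := ht2
        have hij : i ≠ j := fun e => hiJ (e ▸ hj)
        have h2 := hfi t ht2'
        have h3 := hmono_f i j hij (hc0 i t (hp0.trans ht2'.le)) (hct0 i x hx00.le) ht1.le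
        have h4 := hf i
        linarith
    push Not at hnot
    obtain ⟨t, hpt, hct⟩ := hnot
    filter_upwards [(hphi a x).eventually (Iio_mem_nhds hpt), self_mem_nhdsWithin] with u hu hxu
    have hu' : r * (u - a) < t := hu
    have hxu' : x < u := hxu
    calc c j (r * (u - a)) ≤ c j t := hcm j hu'.le
      _ ≤ c j p := hct
      _ = ctil j x := hj1
      _ ≤ ctil j u := hctm j hxu'.le
  · have hss : J' ⊂ J := lt_of_le_of_ne hJ'sub hJJ
    have hall : ∀ᶠ u in 𝓝[>] x, ∀ i, i ∉ J' → c i (r * (u - a)) < ctil i u := by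
      rw [Filter.eventually_all]
      intro i
      by_cases hi : i ∈ J'
      · exact Eventually.of_forall fun _ hn => absurd hi hn
      · filter_upwards [hstrict i hi] with u hu _ using hu
    obtain ⟨z, hxz, hz⟩ := mem_nhdsGT_iff_exists_Ioc_subset.1 hall
    have hxz' : x < z := hxz
    filter_upwards [Ioc_mem_nhdsGT hxz'] with u hu j hj
    by_cases hjJ' : j ∈ J'
    ·
      have hlag : ∀ e ∈ Ioc 0 (u - x), c j (r * (u - (a + e))) ≤ ctil j u := by
        intro e he
        refine ih J' hss (a + e) (x + e) z (by linarith [he.1]) (by linarith) ?_ ?_ u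
          ⟨by linarith [he.2], hu.2⟩ j hjJ'
        · intro k hk
          have e1 : r * (x + e - (a + e)) = p := by rw [hp]; ring
          rw [e1]
          exact (hle k).trans (hctm k (by linarith [he.1]))
        · intro i hi v hv
          have hv' : v ∈ Ioc x z := ⟨by linarith [he.1, hv.1], hv.2⟩
          refine lt_of_le_of_lt (hcm i ?_) (hz hv' i hi)
          have := he.1
          gcongr
          linarith
      have htend : Tendsto (fun e : ℝ => c j (r * (u - (a + e)))) (𝓝[>] 0)
          (𝓝 (c j (r * (u - (a + 0))))) := by
        have : Continuous (fun e : ℝ => c j (r * (u - (a + e)))) :=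
          (hcc j).comp (by fun_prop)
        exact (this.tendsto 0).mono_left nhdsWithin_le_nhds
      rw [add_zero] at htend
      refine le_of_tendsto htend ?_
      filter_upwards [Ioc_mem_nhdsGT (sub_pos.2 hu.1)] with e he using hlag e he
    · exact (hz hu j hjJ').le

end core

lemma aux_main (m : ℕ)
    (f ftil : Fin m → Fin m → ℝ → ℝ) (g gtil : Fin m → ℝ → ℝ)
    (hH : HypH m f g)
    (hle_f : ∀ i j, ∀ x : ℝ, 0 ≤ x → f i j x ≤ ftil i j x)
    (hle_g : ∀ j, ∀ t : ℝ, 0 ≤ t → g j t ≤ gtil j t)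
    (h htil : Fin m → ℝ → ℝ)
    (hsol : IsSolutionOn m f g ⊤ h) (hsoltil : IsSolutionOn m ftil gtil ⊤ htil)
    (hnn : NonnegOn m ⊤ h) (hnntil : NonnegOn m ⊤ htil)
    (hnsg : NoSpontGenOn m f g ⊤ h) :
    ∀ j, ∀ t : ℝ, 0 ≤ t → prim (h j) t ≤ prim (htil j) t := by
  have hnn' : ∀ j, ∀ t : ℝ, 0 ≤ t → 0 ≤ h j t := fun j t ht => hnn j t ht ENNReal.ofReal_lt_top
  have hnnt' : ∀ j, ∀ t : ℝ, 0 ≤ t → 0 ≤ htil j t := fun j t ht =>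
    hnntil j t ht ENNReal.ofReal_lt_top
  choose c hcc hcm hc0 hcp hd using fun j => aux_prim (hsol.1 j) (hnn' j)
  choose ctil hctc hctm hct0 hctp hdt using fun j => aux_prim (hsoltil.1 j) (hnnt' j)
  have heq : ∀ j, ∀ t : ℝ, 0 ≤ t → h j t = (∑ i, f i j (c i t)) + g j t := by
    intro j t ht
    rw [hsol.2 j t ht ENNReal.ofReal_lt_top]
    simp only [fun i => hcp i t ht]
  have heqt : ∀ j, ∀ t : ℝ, 0 ≤ t → htil j t = (∑ i, ftil i j (ctil i t)) + gtil j t := by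
    intro j t ht
    rw [hsoltil.2 j t ht ENNReal.ofReal_lt_top]
    simp only [fun i => hctp i t ht]
  have hnsg' : ∀ s : ℝ, 0 ≤ s → ∀ J : Finset (Fin m), (∀ j ∈ J, h j s = 0) →
      ∀ j ∈ J, (∀ t : ℝ, s < t → c j s < c j t) →
        (∀ t : ℝ, s < t → g j s < g j t) ∨
        ∃ i : Fin m, i ∉ J ∧ ∀ t : ℝ, s < t → f i j (c i s) < f i j (c i t) := by
    intro s hs J hJ j hj hinc
    rcases hnsg s hs ENNReal.ofReal_lt_top J hJ j hj (fun t ht _ => by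
      rw [hcp j s hs, hcp j t (hs.trans ht.le)]; exact hinc t ht) with h1 | ⟨i, hi, h1⟩
    · exact Or.inl fun t ht => h1 t ht ENNReal.ofReal_lt_top
    · refine Or.inr ⟨i, hi, fun t ht => ?_⟩
      have := h1 t ht ENNReal.ofReal_lt_top
      rwa [hcp i s hs, hcp i t (hs.trans ht.le)] at this
  have hcn : ∀ i t, 0 ≤ t → 0 ≤ c i t := fun i t ht => (hc0 i).symm.le.trans (hcm i ht)
  have hctn : ∀ i t, 0 ≤ t → 0 ≤ ctil i t := fun i t ht => (hct0 i).symm.le.trans (hctm i ht)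
  intro j t ht
  rw [hcp j t ht, hctp j t ht]
  rcases ht.eq_or_lt with rfl | ht'
  · rw [hc0, hct0]
  have key : ∀ e ∈ Ioo 0 (min t 1), c j ((1 - e) * (t - e)) ≤ ctil j t := by
    intro e he
    have he1 : e < t := he.2.trans_le (min_le_left _ _)
    have he2 : e < 1 := he.2.trans_le (min_le_right _ _)
    refine aux_core hH.mono_f hH.mono_g hle_f hle_g hcn hctn heq heqt hnn' hnnt' hcc hctc hcm hctm
      hd hdt hnsg' (r := 1 - e) (by linarith) (by linarith [he.1]) Finset.univ e e t he.1 le_rfl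
      ?_ ?_ t ⟨he1.le, le_rfl⟩ j (Finset.mem_univ j)
    · intro k _
      rw [sub_self, mul_zero, hc0]
      exact hctn k e he.1.le
    · intro i hi
      exact absurd (Finset.mem_univ i) hi
  have htend : Tendsto (fun e : ℝ => c j ((1 - e) * (t - e))) (𝓝[>] 0)
      (𝓝 (c j ((1 - 0) * (t - 0)))) := by
    have : Continuous (fun e : ℝ => c j ((1 - e) * (t - e))) := (hcc j).comp (by fun_prop)
    exact (this.tendsto 0).mono_left nhdsWithin_le_nhds
  rw [sub_zero, sub_zero, one_mul] at htend
  refine le_of_tendsto htend ?_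
  filter_upwards [Ioo_mem_nhdsGT (lt_min ht' one_pos)] with e he using key e he

/-- monotonicity and uniqueness via absence of spontaneous generation. -/
theorem stmt3 (m : ℕ) (hm : 1 ≤ m)
    (f ftil : Fin m → Fin m → ℝ → ℝ) (g gtil : Fin m → ℝ → ℝ)
    (hH : HypH m f g) (hHtil : HypH m ftil gtil)
    (hle_f : ∀ i j, ∀ x : ℝ, 0 ≤ x → f i j x ≤ ftil i j x)
    (hle_g : ∀ j, ∀ t : ℝ, 0 ≤ t → g j t ≤ gtil j t)
    (h htil : Fin m → ℝ → ℝ)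
    (hsol : IsSolutionOn m f g ⊤ h) (hsoltil : IsSolutionOn m ftil gtil ⊤ htil)
    (hnn : NonnegOn m ⊤ h) (hnntil : NonnegOn m ⊤ htil)
    (hnsg : NoSpontGenOn m f g ⊤ h) :
    (∀ j, ∀ t : ℝ, 0 ≤ t → prim (h j) t ≤ prim (htil j) t) ∧
    (∀ h₁ h₂ : Fin m → ℝ → ℝ,
      IsSolutionOn m f g ⊤ h₁ → NonnegOn m ⊤ h₁ → NoSpontGenOn m f g ⊤ h₁ →
      IsSolutionOn m f g ⊤ h₂ → NonnegOn m ⊤ h₂ → NoSpontGenOn m f g ⊤ h₂ →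
      ∀ j, ∀ t : ℝ, 0 ≤ t → h₁ j t = h₂ j t) := by
  refine ⟨aux_main m f ftil g gtil hH hle_f hle_g h htil hsol hsoltil hnn hnntil hnsg, ?_⟩
  intro h₁ h₂ s1 n1 g1 s2 n2 g2 j t ht
  have e : ∀ i, prim (h₁ i) t = prim (h₂ i) t := fun i => le_antisymm
    (aux_main m f f g g hH (fun _ _ _ _ => le_rfl) (fun _ _ _ => le_rfl) h₁ h₂ s1 s2 n1 n2 g1 i t ht)
    (aux_main m f f g g hH (fun _ _ _ _ => le_rfl) (fun _ _ _ => le_rfl) h₂ h₁ s2 s1 n2 n1 g2 i t ht)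
  rw [s1.2 j t ht ENNReal.ofReal_lt_top, s2.2 j t ht ENNReal.ofReal_lt_top]
  simp only [e]
end
end

section
/- Let (f^{i,j}, g^j) (1 ≤ i,j ≤ m) satisfy hypotheses (H) and assume additionally that each g^j is strictly increasing. Then every non-negative solution of the time-change system on [0,∞) has no spontaneous generation; consequently the time-change system admits at most one non-negative solution on [0,∞). -/
open MeasureTheory Filter Function Set
open scoped ENNReal Topology

noncomputable section

theorem aux_meas_s5 (h : ℝ → ℝ) (hc : CadlagOn h ⊤) :
    Measurable (Set.indicator (Set.Ici 0) h) := by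
  have hu : ∀ t : ℝ, Tendsto (fun n : ℕ => ((⌊t * ((n:ℝ) + 1)⌋ : ℝ) + 1) / ((n:ℝ) + 1)) atTop
      (𝓝[>] t) := by
    intro t
    rw [tendsto_nhdsWithin_iff]
    have hpos : ∀ n : ℕ, (0:ℝ) < (n:ℝ) + 1 := fun n => by positivity
    constructor
    · have h1 : Tendsto (fun n : ℕ => t + 1 / ((n:ℝ) + 1)) atTop (𝓝 t) := by
        simpa using (tendsto_const_nhds (x := t)).add
          (tendsto_one_div_add_atTop_nhds_zero_nat (𝕜 := ℝ))
      refine tendsto_of_tendsto_of_tendsto_of_le_of_le tendsto_const_nhds h1 ?_ ?_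
      · intro n
        show t ≤ _
        rw [le_div_iff₀ (hpos n)]
        exact (Int.lt_floor_add_one _).le
      · intro n
        show _ ≤ t + 1 / ((n:ℝ) + 1)
        rw [div_le_iff₀ (hpos n), add_mul, one_div, inv_mul_cancel₀ (hpos n).ne']
        have := Int.floor_le (t * ((n:ℝ) + 1))
        linarith
    · refine Eventually.of_forall fun n => ?_
      show t < _
      rw [lt_div_iff₀ (hpos n)]
      exact Int.lt_floor_add_one _
  refine measurable_of_tendsto_metrizable (f := fun (n : ℕ) =>
    Set.indicator (Set.Ici 0) (fun t : ℝ => h (((⌊t * ((n:ℝ) + 1)⌋ : ℝ) + 1) / ((n:ℝ) + 1)))) ?_ ?_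
  · intro n
    refine Measurable.indicator ?_ measurableSet_Ici
    have h1 : Measurable (fun k : ℤ => h (((k : ℝ) + 1) / ((n:ℝ) + 1))) := measurable_from_top
    have h2 : Measurable (fun t : ℝ => ⌊t * ((n:ℝ) + 1)⌋) :=
      Int.measurable_floor.comp (measurable_id.mul_const _)
    exact h1.comp h2
  · rw [tendsto_pi_nhds]
    intro t
    by_cases ht : 0 ≤ t
    · simp only [Set.indicator, Set.mem_Ici, ht, if_true]
      exact (hc.1 t ht ENNReal.ofReal_lt_top).comp (hu t)
    · simp only [Set.indicator, Set.mem_Ici, ht, if_false]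
      exact tendsto_const_nhds

theorem aux_locint (h : ℝ → ℝ) (hc : CadlagOn h ⊤) :
    LocallyIntegrable (Set.indicator (Set.Ici 0) h) volume := by
  have hm := aux_meas_s5 h hc
  intro t
  have hfin : ∀ s : Set ℝ, volume.FiniteAtFilter (𝓝[s] t) := fun s =>
    (volume.finiteAt_nhds t).filter_mono nhdsWithin_le_nhds
  have hsm : ∀ l : Filter ℝ, StronglyMeasurableAtFilter (Set.indicator (Set.Ici 0) h) l volume :=
    fun l => hm.stronglyMeasurable.stronglyMeasurableAtFilter
  have hR : IntegrableAtFilter (Set.indicator (Set.Ici 0) h) (𝓝[>] t) volume := by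
    have : ∃ l, Tendsto (Set.indicator (Set.Ici 0) h) (𝓝[>] t) (𝓝 l) := by
      rcases lt_or_ge t 0 with ht | ht
      · refine ⟨0, tendsto_const_nhds.congr' ?_⟩
        have : Set.Iio (0:ℝ) ∈ 𝓝[>] t := nhdsWithin_le_nhds (Iio_mem_nhds ht)
        filter_upwards [this] with x hx
        simp only [Set.mem_Iio] at hx
        simp [Set.indicator, hx.not_ge]
      · refine ⟨h t, (hc.1 t ht ENNReal.ofReal_lt_top).congr' ?_⟩
        filter_upwards [self_mem_nhdsWithin] with x hx
        simp only [Set.mem_Ioi] at hx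
        simp [Set.indicator, (ht.trans hx.le)]
    obtain ⟨l, hl⟩ := this
    exact (hfin _).integrableAtFilter_of_tendsto (hsm _) hl
  have hL : IntegrableAtFilter (Set.indicator (Set.Ici 0) h) (𝓝[<] t) volume := by
    have : ∃ l, Tendsto (Set.indicator (Set.Ici 0) h) (𝓝[<] t) (𝓝 l) := by
      rcases le_or_gt t 0 with ht | ht
      · refine ⟨0, tendsto_const_nhds.congr' ?_⟩
        filter_upwards [self_mem_nhdsWithin] with x hx
        simp only [Set.mem_Iio] at hx
        simp [Set.indicator, (hx.trans_le ht).not_ge]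
      · obtain ⟨l, hl⟩ := hc.2 t ht ENNReal.ofReal_lt_top
        refine ⟨l, hl.congr' ?_⟩
        have : Set.Ioi (0:ℝ) ∈ 𝓝[<] t := nhdsWithin_le_nhds (Ioi_mem_nhds ht)
        filter_upwards [this] with x hx
        simp only [Set.mem_Ioi] at hx
        simp [Set.indicator, hx.le]
    obtain ⟨l, hl⟩ := this
    exact (hfin _).integrableAtFilter_of_tendsto (hsm _) hl
  have hP : IntegrableAtFilter (Set.indicator (Set.Ici 0) h) (pure t) volume := by
    refine ⟨{t}, by simp, ?_⟩
    simp
  have key : 𝓝 t = 𝓝[<] t ⊔ (pure t ⊔ 𝓝[>] t) := by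
    rw [← nhdsWithin_singleton, ← nhdsWithin_union, ← nhdsWithin_union, ← nhdsWithin_univ]
    congr 1
    ext x
    simp [lt_trichotomy x t]
  rw [key]
  exact IntegrableAtFilter.sup_iff.2 ⟨hL, IntegrableAtFilter.sup_iff.2 ⟨hP, hR⟩⟩

theorem aux_prim_s5 (h : ℝ → ℝ) (t : ℝ) (ht : 0 ≤ t) :
    prim h t = ∫ s in (0:ℝ)..t, Set.indicator (Set.Ici 0) h s := by
  unfold prim
  refine intervalIntegral.integral_congr fun x hx => ?_
  rw [Set.uIcc_of_le ht] at hx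
  simp [Set.indicator, hx.1]

theorem aux_ii (h : ℝ → ℝ) (hc : CadlagOn h ⊤) (a b : ℝ) :
    IntervalIntegrable (Set.indicator (Set.Ici 0) h) volume a b :=
  (((aux_locint h hc).integrableOn_isCompact isCompact_uIcc : IntegrableOn _ (Set.uIcc a b) _)).intervalIntegrable

theorem aux_cont (h : ℝ → ℝ) (hc : CadlagOn h ⊤) : ContinuousOn (prim h) (Set.Ici 0) := by
  have : Continuous (fun t => ∫ s in (0:ℝ)..t, Set.indicator (Set.Ici 0) h s) :=
    intervalIntegral.continuous_primitive
      (fun a b => aux_ii h hc a b) 0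
  exact this.continuousOn.congr fun t ht => aux_prim_s5 h t ht

theorem aux_int (h : ℝ → ℝ) (hc : CadlagOn h ⊤) (a b : ℝ) (ha : 0 ≤ a) (hb : 0 ≤ b) :
    IntervalIntegrable h volume a b := by
  have := aux_ii h hc a b
  refine this.congr fun x hx => ?_
  have hx' : 0 < x := lt_of_le_of_lt (le_min ha hb) hx.1
  simp [Set.indicator, hx'.le]

theorem aux_nonneg (h : ℝ → ℝ) (h0 : ∀ t, 0 ≤ t → 0 ≤ h t) (t : ℝ) (ht : 0 ≤ t) :
    0 ≤ prim h t :=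
  intervalIntegral.integral_nonneg ht fun x hx => h0 x hx.1

theorem aux_sub (h : ℝ → ℝ) (hc : CadlagOn h ⊤) (a b : ℝ) (ha : 0 ≤ a) (hb : 0 ≤ b) :
    prim h b = prim h a + ∫ s in a..b, h s :=
  (intervalIntegral.integral_add_adjacent_intervals (aux_int h hc 0 a le_rfl ha)
    (aux_int h hc a b ha hb)).symm

theorem aux_shift (m : ℕ) (f : Fin m → Fin m → ℝ → ℝ) (g : Fin m → ℝ → ℝ)
    (hH : HypH m f g) (hg_strict : ∀ j, StrictMonoOn (g j) (Set.Ici 0))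
    (h₁ h₂ : Fin m → ℝ → ℝ)
    (s₁ : IsSolutionOn m f g ⊤ h₁) (n₁ : NonnegOn m ⊤ h₁)
    (s₂ : IsSolutionOn m f g ⊤ h₂) (n₂ : NonnegOn m ⊤ h₂) (ε : ℝ) (hε : 0 < ε)
    (T : ℝ) :
    ∀ t ∈ Set.Icc 0 T, ∀ j, prim (h₁ j) t ≤ prim (h₂ j) (t + ε) := by
  have p₁ : ∀ j t, 0 ≤ t → 0 ≤ prim (h₁ j) t := fun j t ht =>
    aux_nonneg _ (fun t ht => n₁ j t ht ENNReal.ofReal_lt_top) t ht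
  have p₂ : ∀ j t, 0 ≤ t → 0 ≤ prim (h₂ j) t := fun j t ht =>
    aux_nonneg _ (fun t ht => n₂ j t ht ENNReal.ofReal_lt_top) t ht
  have c₁ := fun j => aux_cont _ (s₁.1 j)
  have c₂ : ∀ j, ContinuousOn (fun t => prim (h₂ j) (t + ε)) (Set.Ici 0) := fun j =>
    (aux_cont _ (s₂.1 j)).comp (by fun_prop) (fun t ht => by
      simp only [Set.mem_Ici] at *; linarith)
  suffices H : Set.Icc 0 T ⊆ {t | ∀ j, prim (h₁ j) t ≤ prim (h₂ j) (t + ε)} from H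
  refine IsClosed.Icc_subset_of_forall_mem_nhdsWithin ?_ ?_ ?_
  · have : {t | ∀ j, prim (h₁ j) t ≤ prim (h₂ j) (t + ε)} ∩ Set.Icc 0 T =
        Set.Icc 0 T ∩ ⋂ j, {t ∈ Set.Icc 0 T | prim (h₁ j) t ≤ prim (h₂ j) (t + ε)} := by
      ext t
      simp only [Set.mem_inter_iff, Set.mem_ofPred_eq, Set.mem_iInter]
      exact ⟨fun h => ⟨h.2, fun i => ⟨h.2, h.1 i⟩⟩, fun h => ⟨fun i => (h.2 i).2, h.1⟩⟩
    rw [this]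
    refine isClosed_Icc.inter (isClosed_iInter fun j => ?_)
    exact isClosed_Icc.isClosed_le ((c₁ j).mono Set.Icc_subset_Ici_self)
      ((c₂ j).mono Set.Icc_subset_Ici_self)
  · intro j
    have : prim (h₁ j) 0 = 0 := by simp [prim]
    rw [this]
    exact p₂ j _ (by linarith)
  · rintro x ⟨hx, hx0, -⟩
    simp only [Set.mem_ofPred_eq] at hx
    have hxe : 0 ≤ x + ε := by linarith
    show ∀ᶠ t in 𝓝[>] x, ∀ j, prim (h₁ j) t ≤ prim (h₂ j) (t + ε)
    rw [eventually_all]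
    intro j
    rcases (hx j).lt_or_eq with hlt | heq
    · have a₁ : Tendsto (prim (h₁ j)) (𝓝[>] x) (𝓝 (prim (h₁ j) x)) :=
        ((c₁ j) x hx0).mono_left (nhdsWithin_mono _ fun y hy => hx0.trans (le_of_lt hy))
      have a₂ : Tendsto (fun t => prim (h₂ j) (t + ε)) (𝓝[>] x) (𝓝 (prim (h₂ j) (x + ε))) :=
        ((c₂ j) x hx0).mono_left (nhdsWithin_mono _ fun y hy => hx0.trans (le_of_lt hy))
      exact (a₁.eventually_lt a₂ hlt).mono fun _ h => h.le
    · have hlt : h₁ j x < h₂ j (x + ε) := by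
        rw [s₁.2 j x hx0 ENNReal.ofReal_lt_top, s₂.2 j _ hxe ENNReal.ofReal_lt_top]
        refine add_lt_add_of_le_of_lt (Finset.sum_le_sum fun i _ => ?_)
          (hg_strict j hx0 hxe (by linarith))
        by_cases hij : i = j
        · subst hij
          rw [heq]
        · exact hH.mono_f i j hij (p₁ i x hx0) (p₂ i _ hxe) (hx i)
      have sh : Tendsto (fun t => t + ε) (𝓝[>] x) (𝓝[>] (x + ε)) := by
        rw [tendsto_nhdsWithin_iff]
        constructor
        · have : Continuous (fun t : ℝ => t + ε) := by fun_prop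
          exact (this.tendsto x).mono_left nhdsWithin_le_nhds
        · filter_upwards [self_mem_nhdsWithin] with y hy
          simp only [Set.mem_Ioi] at *
          linarith
      have ev : ∀ᶠ t in 𝓝[>] x, h₁ j t < h₂ j (t + ε) :=
        ((s₁.1 j).1 x hx0 ENNReal.ofReal_lt_top).eventually_lt
          (((s₂.1 j).1 _ hxe ENNReal.ofReal_lt_top).comp sh) hlt
      obtain ⟨u, hu, hsub⟩ := mem_nhdsGT_iff_exists_Ioo_subset.1 ev
      filter_upwards [Ioo_mem_nhdsGT hu] with t ht
      have hxt : x ≤ t := ht.1.le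
      have ht0 : 0 ≤ t := le_trans hx0 hxt
      rw [aux_sub _ (s₁.1 j) x t hx0 ht0, aux_sub _ (s₂.1 j) (x + ε) (t + ε) hxe (by linarith),
        ← intervalIntegral.integral_comp_add_right (fun s => h₂ j s) ε, heq]
      have := intervalIntegral.integral_mono_on_of_le_Ioo (f := h₁ j)
        (g := fun s => h₂ j (s + ε)) hxt (aux_int _ (s₁.1 j) x t hx0 ht0)
        (by
          have := (aux_int _ (s₂.1 j) (x + ε) (t + ε) hxe (by linarith)).comp_add_right ε
          simpa using this)
        (fun s hs => (hsub ⟨hs.1, hs.2.trans ht.2⟩ : h₁ j s < h₂ j (s + ε)).le)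
      linarith

theorem aux_le (m : ℕ) (f : Fin m → Fin m → ℝ → ℝ) (g : Fin m → ℝ → ℝ)
    (hH : HypH m f g) (hg_strict : ∀ j, StrictMonoOn (g j) (Set.Ici 0))
    (h₁ h₂ : Fin m → ℝ → ℝ)
    (s₁ : IsSolutionOn m f g ⊤ h₁) (n₁ : NonnegOn m ⊤ h₁)
    (s₂ : IsSolutionOn m f g ⊤ h₂) (n₂ : NonnegOn m ⊤ h₂) (j : Fin m) (t : ℝ) (ht : 0 ≤ t) :
    prim (h₁ j) t ≤ prim (h₂ j) t := by
  have a : Tendsto (prim (h₂ j)) (𝓝[>] t) (𝓝 (prim (h₂ j) t)) :=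
    ((aux_cont _ (s₂.1 j)) t ht).mono_left
      (nhdsWithin_mono _ fun y hy => ht.trans (le_of_lt hy))
  refine ge_of_tendsto a ?_
  filter_upwards [self_mem_nhdsWithin] with y hy
  have := aux_shift m f g hH hg_strict h₁ h₂ s₁ n₁ s₂ n₂ (y - t) (sub_pos.2 hy) t t
    ⟨ht, le_rfl⟩ j
  simpa using this

/-- strictly increasing immigration implies no spontaneous generation,
hence uniqueness. -/
theorem stmt5 (m : ℕ) (hm : 1 ≤ m)
    (f : Fin m → Fin m → ℝ → ℝ) (g : Fin m → ℝ → ℝ)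
    (hH : HypH m f g)
    (hg_strict : ∀ j, StrictMonoOn (g j) (Set.Ici 0)) :
    (∀ h : Fin m → ℝ → ℝ, IsSolutionOn m f g ⊤ h → NonnegOn m ⊤ h →
      NoSpontGenOn m f g ⊤ h) ∧
    (∀ h₁ h₂ : Fin m → ℝ → ℝ,
      IsSolutionOn m f g ⊤ h₁ → NonnegOn m ⊤ h₁ →
      IsSolutionOn m f g ⊤ h₂ → NonnegOn m ⊤ h₂ →
      ∀ j, ∀ t : ℝ, 0 ≤ t → h₁ j t = h₂ j t) := by
  refine ⟨?_, ?_⟩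
  · intro h _ _ s hs _ J _ j _ _
    left
    intro t hst _
    exact hg_strict j hs (hs.trans hst.le) hst
  · intro h₁ h₂ s₁ n₁ s₂ n₂ j t ht
    rw [s₁.2 j t ht ENNReal.ofReal_lt_top, s₂.2 j t ht ENNReal.ofReal_lt_top]
    congr 1
    refine Finset.sum_congr rfl fun i _ => ?_
    rw [le_antisymm (aux_le m f g hH hg_strict h₁ h₂ s₁ n₁ s₂ n₂ i t ht)
      (aux_le m f g hH hg_strict h₂ h₁ s₂ n₂ s₁ n₁ i t ht)]
end
end
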